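/- For every integer n ≥ 0, ζ⋆({1,3}^n, 1, 2) + ζ⋆(3, {1,3}^n) = (4 − 16^{−n})·ζ(4n+3). -/

import Mathlib

/-- The monotone index sequence `n_0 ≤ n_1 ≤ ⋯` of positive integers parametrized by the
gap function `g`: `n i = 1 + g 0 + g 1 + ⋯ + g i`.  Every weakly increasing tuple
`1 ≤ n_0 ≤ ⋯ ≤ n_{d−1}` arises from exactly one `g : Fin d → ℕ`. -/
def idxSeq {d : ℕ} (g : Fin d → ℕ) (i : Fin d) : ℕ :=
  1 + ∑ j ∈ Finset.univ.filter (· ≤ i), g j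

/-- The multiple zeta star value
`ζ⋆(s₁,…,s_d) = ∑_{1 ≤ n₁ ≤ n₂ ≤ ⋯ ≤ n_d} 1/(n₁^{s₁} ⋯ n_d^{s_d})`. -/
noncomputable def zetaStar {d : ℕ} (s : Fin d → ℕ) : ℝ :=
  ∑' g : Fin d → ℕ, ∏ i, 1 / (idxSeq g i : ℝ) ^ s i

/-- The repeating string `{1,3}^n`: entries alternate `1, 3, 1, 3, …` (length `2n`). -/
def pat13 (n : ℕ) : Fin (2 * n) → ℕ := fun i => if (i : ℕ) % 2 = 0 then 1 else 3

open Filter Topology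

/-- The kernel `N!^2/((N-j)!(N+j)!)`, written as a product. -/
noncomputable def kerB (N : ℕ) : ℕ → ℝ
  | 0 => 1
  | j + 1 => kerB N j * (((N : ℝ) - j) / (N + j + 1))

lemma kerB_succ (N j : ℕ) : kerB N (j + 1) * ((N : ℝ) + j + 1) = kerB N j * ((N : ℝ) - j) := by
  have : (N : ℝ) + j + 1 ≠ 0 := by positivity
  simp only [kerB]
  field_simp

lemma kerB_step (N j : ℕ) :
    ((N : ℝ) + 1) ^ 2 * kerB N j = kerB (N + 1) j * (((N : ℝ) + 1) ^ 2 - (j : ℝ) ^ 2) := by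
  induction j with
  | zero => simp [kerB]
  | succ j ih =>
    have h1 : (N : ℝ) + j + 1 ≠ 0 := by positivity
    have h2 : (N : ℝ) + 1 + j + 1 ≠ 0 := by positivity
    simp only [kerB]
    push_cast
    have : ((N : ℝ) + 1) ^ 2 * (kerB N j * (((N : ℝ) - j) / (N + j + 1)))
        = (((N : ℝ) + 1) ^ 2 * kerB N j) * (((N : ℝ) - j) / (N + j + 1)) := by ring
    rw [this, ih]
    field_simp
    ring

lemma kerB_eq_zero (N j : ℕ) (h : N < j) : kerB N j = 0 := by
  induction j with
  | zero => omega
  | succ j ih =>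
    simp only [kerB]
    rcases Nat.lt_or_ge N j with h' | h'
    · rw [ih h']; simp
    · have : N = j := by omega
      subst this; simp

lemma kerB_mem (N j : ℕ) : 0 ≤ kerB N j ∧ kerB N j ≤ 1 := by
  induction j with
  | zero => simp [kerB]
  | succ j ih =>
    rcases Nat.lt_or_ge N (j + 1) with h' | h'
    · rw [kerB_eq_zero _ _ h']; simp
    · have hj : (j : ℝ) + 1 ≤ N := by exact_mod_cast h'
      have h0 : 0 ≤ ((N : ℝ) - j) / (N + j + 1) := by
        apply div_nonneg <;> linarith [(Nat.cast_nonneg j : (0 : ℝ) ≤ j)]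
      have h1 : ((N : ℝ) - j) / (N + j + 1) ≤ 1 := by
        rw [div_le_one (by positivity)]
        linarith [(Nat.cast_nonneg j : (0 : ℝ) ≤ j)]
      simp only [kerB]
      exact ⟨mul_nonneg ih.1 h0, mul_le_one₀ ih.2 h0 h1⟩

lemma kerB_pos (N j : ℕ) (h : j ≤ N) : 0 < kerB N j := by
  induction j with
  | zero => simp [kerB]
  | succ j ih =>
    have hj : (j : ℝ) + 1 ≤ N := by exact_mod_cast h
    simp only [kerB]
    apply mul_pos (ih (by omega))
    apply div_pos <;> linarith [(Nat.cast_nonneg j : (0 : ℝ) ≤ j)]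

lemma kerB_tendsto (j : ℕ) : Tendsto (fun N => kerB N j) atTop (𝓝 1) := by
  induction j with
  | zero => simp [kerB]
  | succ j ih =>
    simp only [kerB]
    have h : Tendsto (fun N : ℕ => ((N : ℝ) - j) / (N + j + 1)) atTop (𝓝 1) := by
      have h2 : Tendsto (fun N : ℕ => 1 - (2 * (j : ℝ) + 1) / ((N : ℝ) + (j + 1))) atTop
          (𝓝 (1 - 0)) := by
        refine tendsto_const_nhds.sub ?_
        apply Tendsto.const_div_atTop
        exact tendsto_atTop_add_const_right _ _ tendsto_natCast_atTop_atTop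
      rw [sub_zero] at h2
      refine h2.congr fun N => ?_
      have h1 : (N : ℝ) + j + 1 ≠ 0 := by positivity
      have h1' : (N : ℝ) + (j + 1) ≠ 0 := by positivity
      field_simp
      ring
    simpa using ih.mul h

lemma kerB_fact (N j : ℕ) (h : j ≤ N) :
    kerB N j * ((N - j).factorial * (N + j).factorial : ℝ) = (N.factorial : ℝ) ^ 2 := by
  induction j with
  | zero => simp [kerB, sq]
  | succ j ih =>
    rw [← ih (by omega)]
    have h1 : N - j = (N - (j + 1)) + 1 := by omega
    have h3 : ((N - (j + 1) : ℕ) : ℝ) = (N : ℝ) - j - 1 := by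
      rw [Nat.cast_sub h]; push_cast; ring
    rw [h1, Nat.factorial_succ, ← add_assoc, Nat.factorial_succ]
    push_cast
    rw [h3]
    have := kerB_succ N j
    linear_combination ((N - (j + 1)).factorial * (N + j).factorial : ℝ) * this

/-- Summation by parts against the kernel. -/
lemma kerB_parts (P : ℕ → ℝ) (h0 : P 0 = 0) (N : ℕ) :
    ∑ j ∈ Finset.range N, ((j : ℝ) + 1) * (P (j + 1) + P j) * kerB N (j + 1)
      = N * ∑ j ∈ Finset.range N, (P (j + 1) - P j) * kerB N (j + 1) := by
  have key : ∀ M : ℕ, ∑ j ∈ Finset.range M, ((j : ℝ) + 1) * (P (j + 1) + P j) * kerB N (j + 1)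
      = N * ∑ j ∈ Finset.range M, (P (j + 1) - P j) * kerB N (j + 1)
        - kerB N M * (N - M) * P M := by
    intro M
    induction M with
    | zero => simp [h0]
    | succ M ih =>
      rw [Finset.sum_range_succ, Finset.sum_range_succ, ih]
      have := kerB_succ N M
      push_cast
      linear_combination P M * this
  rw [key N]; simp

lemma kerB_sum_sq (N j : ℕ) :
    ∑ m ∈ Finset.range N, kerB (m + 1) (j + 1) / ((m : ℝ) + 1) ^ 2
      = kerB N (j + 1) / ((j : ℝ) + 1) ^ 2 := by
  induction N with
  | zero => simp [kerB_eq_zero]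
  | succ N ih =>
    rw [Finset.sum_range_succ, ih]
    have := kerB_step N (j + 1)
    push_cast at this
    have h1 : (N : ℝ) + 1 ≠ 0 := by positivity
    have h2 : (j : ℝ) + 1 ≠ 0 := by positivity
    field_simp
    linear_combination this

/-- The kernel of the second transport. -/
noncomputable def kerb (M : ℝ) : ℕ → ℝ
  | 0 => 1 / M
  | l + 1 => kerb M l * (((l : ℝ) + 1) ^ 2 / (((l : ℝ) + 1) ^ 2 - M ^ 2))

lemma kerb_shift (M l : ℕ) (h : l < M) :
    ((M : ℝ) + 1 + l) * kerb ((M : ℝ) + 1) l = ((M : ℝ) - l) * kerb M l := by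
  induction l with
  | zero =>
    have : (M : ℝ) ≠ 0 := by
      have : 0 < M := by omega
      positivity
    have h1 : (M : ℝ) + 1 ≠ 0 := by positivity
    simp only [kerb]; push_cast; field_simp; ring
  | succ l ih =>
    have ih := ih (by omega)
    have hl : (l : ℝ) + 1 < M := by exact_mod_cast h
    have hl0 : (0 : ℝ) ≤ l := Nat.cast_nonneg l
    have h1 : ((l : ℝ) + 1) ^ 2 - M ^ 2 ≠ 0 := by nlinarith
    have h2 : ((l : ℝ) + 1) ^ 2 - ((M : ℝ) + 1) ^ 2 ≠ 0 := by nlinarith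
    have h3 : (M : ℝ) + 1 + l ≠ 0 := by positivity
    have h4 : kerb ((M : ℝ) + 1) l = ((M : ℝ) - l) * kerb M l / ((M : ℝ) + 1 + l) := by
      rw [← ih]; field_simp
    simp only [kerb]
    rw [h4]
    push_cast
    field_simp
    ring

lemma kerb_fact (M l : ℕ) (h : l < M) :
    kerb M l * (M + l).factorial = (-1) ^ l * (l.factorial : ℝ) ^ 2 * (M - l - 1).factorial := by
  induction l with
  | zero =>
    obtain ⟨m, rfl⟩ : ∃ m, M = m + 1 := ⟨M - 1, by omega⟩
    have h1 : (m : ℝ) + 1 ≠ 0 := by positivity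
    simp [kerb, Nat.factorial_succ]
    field_simp
  | succ l ih =>
    have ih := ih (by omega)
    have hl : (l : ℝ) + 1 < M := by exact_mod_cast h
    have hl0 : (0 : ℝ) ≤ l := Nat.cast_nonneg l
    have h1 : ((l : ℝ) + 1) ^ 2 - M ^ 2 ≠ 0 := by nlinarith
    have h5 : M - l - 1 = (M - (l + 1) - 1) + 1 := by omega
    have h6 : ((M - (l + 1) - 1 : ℕ) : ℝ) = (M : ℝ) - l - 2 := by
      rw [Nat.sub_sub, Nat.cast_sub (by omega)]; push_cast; ring
    rw [h5, Nat.factorial_succ] at ih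
    push_cast at ih
    rw [h6] at ih
    simp only [kerb]
    rw [← add_assoc, Nat.factorial_succ, Nat.factorial_succ]
    push_cast
    have h7 : (M : ℝ) - l - 1 ≠ 0 := by linarith
    have h8 : (M : ℝ) + l + 1 ≠ 0 := by positivity
    have h9 : ((l : ℝ) + 1) ^ 2 - M ^ 2 = -((M : ℝ) - l - 1) * (M + l + 1) := by ring
    rw [h9]
    have h10 : -((M : ℝ) - l - 1) * (M + l + 1) ≠ 0 := h9 ▸ h1
    field_simp
    rw [pow_succ]
    linear_combination -ih

lemma kerb_tendsto (l : ℕ) :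
    Tendsto (fun J : ℕ => ((J : ℝ) + 1) * kerb ((J : ℝ) + 1) (l + 1)) atTop (𝓝 0) := by
  have hf : ∀ l : ℕ, Tendsto (fun J : ℕ => ((l : ℝ) + 1) ^ 2 / (((l : ℝ) + 1) ^ 2 - ((J : ℝ) + 1) ^ 2))
      atTop (𝓝 0) := by
    intro l
    apply Tendsto.const_div_atBot
    apply tendsto_atBot_add_const_left
    apply tendsto_neg_atTop_atBot.comp
    refine tendsto_atTop_mono (f := fun J : ℕ => (J : ℝ)) (fun J => ?_) tendsto_natCast_atTop_atTop
    have : (0 : ℝ) ≤ J := Nat.cast_nonneg J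
    nlinarith
  induction l with
  | zero =>
    refine (hf 0).congr fun J => ?_
    have h1 : (J : ℝ) + 1 ≠ 0 := by positivity
    simp only [kerb]
    field_simp
  | succ l ih =>
    have := ih.mul (hf (l + 1))
    rw [mul_zero] at this
    refine this.congr fun J => ?_
    conv_rhs => rw [kerb]
    ring

/-- The explicit solution sequence `A` attached to the pole `k`. -/
noncomputable def seqA (k : ℕ) : ℕ → ℝ
  | 0 => 0
  | j + 1 =>
    if j + 1 < k then 0
    else if j + 1 = k then (k : ℝ) ^ 2 / kerB k k
    else if Even (j + 1 + k) then
      seqA k j * ((((j : ℝ) + 1) ^ 2 + (k : ℝ) ^ 2) / (((j : ℝ) + 1) ^ 2 - (k : ℝ) ^ 2))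
    else
      seqA k j * ((((j : ℝ) + 1) ^ 2 - (k : ℝ) ^ 2) / (((j : ℝ) + 1) ^ 2 + (k : ℝ) ^ 2))

noncomputable def seqQ (k j : ℕ) : ℝ := (-1) ^ (j + k) * seqA k j

lemma seqA_lt (k j : ℕ) (h : j < k) : seqA k j = 0 := by
  cases j with
  | zero => rfl
  | succ j => rw [seqA, if_pos h]

lemma seqA_self (k : ℕ) (hk : 1 ≤ k) : seqA k k = (k : ℝ) ^ 2 / kerB k k := by
  obtain ⟨m, rfl⟩ : ∃ m, k = m + 1 := ⟨k - 1, by omega⟩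
  rw [seqA, if_neg (lt_irrefl _), if_pos rfl]

lemma seqQ_self (k : ℕ) : seqQ k k = seqA k k := by
  rw [seqQ, (Even.add_self k).neg_one_pow, one_mul]

lemma seqQ_lt (k j : ℕ) (h : j < k) : seqQ k j = 0 := by
  rw [seqQ, seqA_lt _ _ h, mul_zero]

lemma seqA_rel (k j : ℕ) (hk : 1 ≤ k) :
    (k : ℝ) ^ 2 * (seqA k (j + 1) + seqA k j) = ((j : ℝ) + 1) ^ 2 * (seqQ k (j + 1) + seqQ k j) ∧
    (k : ℝ) ^ 2 * (seqQ k (j + 1) - seqQ k j) = ((j : ℝ) + 1) ^ 2 * (seqA k (j + 1) - seqA k j) := by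
  rcases lt_trichotomy (j + 1) k with h | h | h
  · rw [seqA_lt _ _ h, seqA_lt k j (by omega), seqQ_lt _ _ h, seqQ_lt k j (by omega)]; simp
  · rw [seqA_lt k j (by omega), seqQ_lt k j (by omega)]
    subst h
    rw [seqQ_self]; push_cast; simp
  · have hj : (k : ℝ) < (j : ℝ) + 1 := by exact_mod_cast h
    have hk0 : (0 : ℝ) < k := by exact_mod_cast hk
    have h1 : ((j : ℝ) + 1) ^ 2 - (k : ℝ) ^ 2 ≠ 0 := by nlinarith
    have h2 : ((j : ℝ) + 1) ^ 2 + (k : ℝ) ^ 2 ≠ 0 := by positivity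
    by_cases he : Even (j + 1 + k)
    · have ho : Odd (j + k) := by
        rw [← Nat.not_even_iff_odd]; intro h'; rw [add_right_comm, Nat.even_add_one] at he
        exact he h'
      have e1 : seqA k (j + 1) = seqA k j * ((((j : ℝ) + 1) ^ 2 + (k : ℝ) ^ 2) / (((j : ℝ) + 1) ^ 2 - (k : ℝ) ^ 2)) := by
        rw [seqA, if_neg (by omega), if_neg (by omega), if_pos he]
      simp only [seqQ]
      rw [he.neg_one_pow, ho.neg_one_pow, e1]
      constructor <;> field_simp <;> ring
    · have ho : Even (j + k) := by
        rw [add_right_comm, Nat.even_add_one, not_not] at he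
        exact he
      have he' := Nat.not_even_iff_odd.1 he
      have e1 : seqA k (j + 1) = seqA k j * ((((j : ℝ) + 1) ^ 2 - (k : ℝ) ^ 2) / (((j : ℝ) + 1) ^ 2 + (k : ℝ) ^ 2)) := by
        rw [seqA, if_neg (by omega), if_neg (by omega), if_neg he]
      simp only [seqQ]
      rw [he'.neg_one_pow, ho.neg_one_pow, e1]
      constructor <;> field_simp <;> ring

lemma seqA_bdd (k : ℕ) (hk : 1 ≤ k) (i : ℕ) :
    0 ≤ seqA k (k + i) ∧ seqA k (k + i) ≤ seqA k k ∧
      (Even (k + i + k) → seqA k (k + i + 1) ≤ seqA k k) ∧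
      (¬ Even (k + i + k) → seqA k (k + i) * ((((k + i : ℕ) : ℝ) + 1) ^ 2 + (k : ℝ) ^ 2) ≤
        seqA k k * ((((k + i : ℕ) : ℝ) + 1) ^ 2 - (k : ℝ) ^ 2)) := by
  have hk0 : (0 : ℝ) < k := by exact_mod_cast hk
  have hA : 0 ≤ seqA k k := by
    rw [seqA_self k hk]; exact div_nonneg (by positivity) (kerB_mem k k).1
  induction i with
  | zero =>
    refine ⟨hA, le_rfl, fun _ => ?_, fun h => absurd (Even.add_self k) (by simp at h)⟩
    have h1 : ¬ Even (k + 0 + 1 + k) := by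
      rw [add_zero, add_right_comm, Nat.even_add_one, not_not]; exact Even.add_self k
    rw [seqA, if_neg (by omega), if_neg (by omega), if_neg h1]
    apply mul_le_of_le_one_right hA
    rw [div_le_one (by positivity)]
    nlinarith
  | succ i ih =>
    obtain ⟨i1, i2, i3, i4⟩ := ih
    have hp : (k : ℝ) ≤ ((k + i : ℕ) : ℝ) := by exact_mod_cast Nat.le_add_right k i
    set m : ℝ := ((k + i : ℕ) : ℝ) with hm
    have hd : 0 < (m + 1) ^ 2 - (k : ℝ) ^ 2 := by nlinarith
    have hd2 : 0 < (m + 1 + 1) ^ 2 - (k : ℝ) ^ 2 := by nlinarith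
    have hs : (((k + (i + 1) : ℕ)) : ℝ) = m + 1 := by rw [hm]; push_cast; ring
    by_cases he : Even (k + i + 1 + k)
    · have ho : ¬ Even (k + i + k) := by
        rw [add_right_comm, Nat.even_add_one] at he; exact he
      have e1 : seqA k (k + (i + 1)) = seqA k (k + i) * (((m + 1) ^ 2 + (k : ℝ) ^ 2) / ((m + 1) ^ 2 - (k : ℝ) ^ 2)) := by
        rw [← add_assoc, seqA, if_neg (by omega), if_neg (by omega), if_pos he]
      have h4 := i4 ho
      have hle : seqA k (k + (i + 1)) ≤ seqA k k := by
        rw [e1, ← mul_div_assoc, div_le_iff₀ hd]; exact h4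
      have hnn : 0 ≤ seqA k (k + (i + 1)) := by
        rw [e1]; exact mul_nonneg i1 (div_nonneg (by positivity) hd.le)
      refine ⟨hnn, hle, fun _ => ?_, fun h => absurd he (by rwa [← add_assoc] at h)⟩
      have h1 : ¬ Even (k + (i + 1) + 1 + k) := by
        rw [add_right_comm, Nat.even_add_one, not_not, ← add_assoc]; exact he
      rw [seqA, if_neg (by omega), if_neg (by omega), if_neg h1, hs]
      refine le_trans ?_ hle
      apply mul_le_of_le_one_right hnn
      rw [div_le_one (by positivity)]
      nlinarith
    · have ho : Even (k + i + k) := by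
        rw [add_right_comm, Nat.even_add_one, not_not] at he; exact he
      have e1 : seqA k (k + (i + 1)) = seqA k (k + i) * (((m + 1) ^ 2 - (k : ℝ) ^ 2) / ((m + 1) ^ 2 + (k : ℝ) ^ 2)) := by
        rw [← add_assoc, seqA, if_neg (by omega), if_neg (by omega), if_neg he]
      have hq : 0 < (m + 1) ^ 2 + (k : ℝ) ^ 2 := by positivity
      refine ⟨?_, i3 ho, fun h => absurd (by rwa [← add_assoc] at h) he, fun _ => ?_⟩
      · rw [e1]; exact mul_nonneg i1 (div_nonneg hd.le hq.le)
      · rw [e1, hs]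
        have : seqA k (k + i) * (((m + 1) ^ 2 - (k : ℝ) ^ 2) / ((m + 1) ^ 2 + (k : ℝ) ^ 2)) *
            ((m + 1 + 1) ^ 2 + (k : ℝ) ^ 2) =
            seqA k (k + i) * ((((m + 1) ^ 2 - (k : ℝ) ^ 2) * ((m + 1 + 1) ^ 2 + (k : ℝ) ^ 2)) / ((m + 1) ^ 2 + (k : ℝ) ^ 2)) := by
          ring
        rw [this]
        refine mul_le_mul i2 ?_ (by positivity) hA
        rw [div_le_iff₀ hq]
        have : 0 ≤ (k : ℝ) ^ 2 * ((m + 2) ^ 2 - (m + 1) ^ 2) := by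
          apply mul_nonneg (by positivity); nlinarith
        nlinarith

lemma seqA_bound (k : ℕ) (hk : 1 ≤ k) (j : ℕ) : |seqA k j| ≤ seqA k k := by
  have hA := (seqA_bdd k hk 0).1
  rcases lt_or_ge j k with h | h
  · rw [seqA_lt _ _ h]; simpa using hA
  · obtain ⟨i, rfl⟩ := Nat.exists_eq_add_of_le h
    obtain ⟨h1, h2, -⟩ := seqA_bdd k hk i
    rwa [abs_of_nonneg h1]

lemma seqQ_bound (k : ℕ) (hk : 1 ≤ k) (j : ℕ) : |seqQ k j| ≤ seqA k k := by
  rw [seqQ, abs_mul, abs_pow, abs_neg, abs_one, one_pow, one_mul]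
  exact seqA_bound k hk j

section transport
variable (k : ℕ) (e h : ℕ → ℝ)

noncomputable def lamK (J : ℕ) : ℝ :=
  e 0 / (k : ℝ) ^ 2 + ∑ l ∈ Finset.range k,
    (k : ℝ) ^ 2 * h l / ((l : ℝ) + 1) ^ 3 * (((J : ℝ) + 1 + (l + 1)) * kerb ((J : ℝ) + 1) (l + 1))

noncomputable def kapK (J : ℕ) : ℝ :=
  ∑ l ∈ Finset.range k,
    e l / ((l : ℝ) + 1) ^ 2 * (((J : ℝ) + 1 + (l + 1)) * kerb ((J : ℝ) + 1) (l + 1))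

lemma lamK_succ (J : ℕ) (hJ : k ≤ J) : lamK k e h (J + 1) = e 0 / (k : ℝ) ^ 2 + ∑ l ∈ Finset.range k,
    (k : ℝ) ^ 2 * h l / ((l : ℝ) + 1) ^ 3 * (((J : ℝ) + 1 - (l + 1)) * kerb ((J : ℝ) + 1) (l + 1)) := by
  rw [lamK]
  congr 1
  refine Finset.sum_congr rfl fun l hl => ?_
  have := kerb_shift (J + 1) (l + 1) (by have := Finset.mem_range.1 hl; omega)
  push_cast at this ⊢
  rw [this]

lemma kapK_succ (J : ℕ) (hJ : k ≤ J) : kapK k e (J + 1) = ∑ l ∈ Finset.range k,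
    e l / ((l : ℝ) + 1) ^ 2 * (((J : ℝ) + 1 - (l + 1)) * kerb ((J : ℝ) + 1) (l + 1)) := by
  rw [kapK]
  refine Finset.sum_congr rfl fun l hl => ?_
  have := kerb_shift (J + 1) (l + 1) (by have := Finset.mem_range.1 hl; omega)
  push_cast at this ⊢
  rw [this]

lemma kerb_rec (M : ℝ) (l : ℕ) (hM : ((l : ℝ) + 1) ^ 2 - M ^ 2 ≠ 0) :
    kerb M l = kerb M (l + 1) * (((l : ℝ) + 1) ^ 2 - M ^ 2) / ((l : ℝ) + 1) ^ 2 := by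
  have : (l : ℝ) + 1 ≠ 0 := by positivity
  simp only [kerb]; field_simp

lemma tele_e (he : ∀ l : ℕ, e (l + 1) = e l + (k : ℝ) ^ 4 * h l / ((l : ℝ) + 1) ^ 3)
    (M K : ℕ) (hM : 0 < M) (hK : K < M) :
    e 0 + M * ∑ l ∈ Finset.range K, ((k : ℝ) ^ 4 * h l / ((l : ℝ) + 1) ^ 3
      + (M : ℝ) ^ 2 * e l / ((l : ℝ) + 1) ^ 2) * kerb M (l + 1) = M * e K * kerb M K := by
  have hM0 : (M : ℝ) ≠ 0 := by positivity
  induction K with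
  | zero => simp [kerb]; field_simp
  | succ K ih =>
    have hl : (K : ℝ) + 1 < M := by exact_mod_cast hK
    have hl0 : (0 : ℝ) ≤ K := Nat.cast_nonneg K
    have h1 : ((K : ℝ) + 1) ^ 2 - (M : ℝ) ^ 2 ≠ 0 := by nlinarith
    have h2 : (K : ℝ) + 1 ≠ 0 := by positivity
    rw [Finset.sum_range_succ, mul_add, ← add_assoc, ih (by omega), kerb_rec _ _ h1, he K]
    field_simp
    ring

lemma tele_h (hh : ∀ l : ℕ, h (l + 1) = h l + e l / ((l : ℝ) + 1))
    (M K : ℕ) (hM : 0 < M) (hK : K < M) :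
    ∑ l ∈ Finset.range K, ((M : ℝ) ^ 2 * h l / ((l : ℝ) + 1) ^ 2
      + e l / ((l : ℝ) + 1)) * kerb M (l + 1) = h K * kerb M K - h 0 / M := by
  have hM0 : (M : ℝ) ≠ 0 := by positivity
  induction K with
  | zero => simp [kerb]; field_simp; simp
  | succ K ih =>
    have hl : (K : ℝ) + 1 < M := by exact_mod_cast hK
    have hl0 : (0 : ℝ) ≤ K := Nat.cast_nonneg K
    have h1 : ((K : ℝ) + 1) ^ 2 - (M : ℝ) ^ 2 ≠ 0 := by nlinarith
    have h2 : (K : ℝ) + 1 ≠ 0 := by positivity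
    rw [Finset.sum_range_succ, ih (by omega), kerb_rec _ _ h1, hh K]
    field_simp
    ring

end transport

section transport2
variable (K : ℕ) (e h : ℕ → ℝ)

lemma eh_zero (he : ∀ l : ℕ, e (l + 1) = e l + ((K + 1 : ℕ) : ℝ) ^ 4 * h l / ((l : ℝ) + 1) ^ 3)
    (hh : ∀ l : ℕ, h (l + 1) = h l + e l / ((l : ℝ) + 1))
    (hz : e K + ((K : ℝ) + 1) * h K = 0) : e (K + 1) = 0 ∧ h (K + 1) = 0 := by
  have h1 : (K : ℝ) + 1 ≠ 0 := by positivity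
  constructor
  · rw [he]; push_cast; rw [← hz]; field_simp
  · rw [hh]; field_simp; linarith

lemma lam_eq1 (he : ∀ l : ℕ, e (l + 1) = e l + ((K + 1 : ℕ) : ℝ) ^ 4 * h l / ((l : ℝ) + 1) ^ 3)
    (hh : ∀ l : ℕ, h (l + 1) = h l + e l / ((l : ℝ) + 1))
    (hz : e K + ((K : ℝ) + 1) * h K = 0) (J : ℕ) (hJ : K + 1 ≤ J) :
    ((K + 1 : ℕ) : ℝ) ^ 2 * (lamK (K + 1) e h (J + 1) + lamK (K + 1) e h J)
      + ((J : ℝ) + 1) ^ 2 * (kapK (K + 1) e (J + 1) + kapK (K + 1) e J) = 0 := by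
  have t := tele_e (K + 1) e h he (J + 1) (K + 1) (by omega) (by omega)
  rw [(eh_zero K e h he hh hz).1] at t
  have hk : ((K + 1 : ℕ) : ℝ) ≠ 0 := by positivity
  rw [lamK_succ _ _ _ _ hJ, kapK_succ _ _ _ hJ, lamK, kapK]
  push_cast at t hk ⊢
  have e1 : ∀ a b c d E : ℝ, ((K : ℝ) + 1) ^ 2 * (E / ((K : ℝ) + 1) ^ 2 + a + (E / ((K : ℝ) + 1) ^ 2 + b))
      + ((J : ℝ) + 1) ^ 2 * (c + d) = 2 * E + ((((K : ℝ) + 1) ^ 2 * a + ((K : ℝ) + 1) ^ 2 * b)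
        + (((J : ℝ) + 1) ^ 2 * c + ((J : ℝ) + 1) ^ 2 * d)) := by
    intro a b c d E; field_simp; ring
  rw [e1, Finset.mul_sum, Finset.mul_sum, Finset.mul_sum, Finset.mul_sum,
    ← Finset.sum_add_distrib, ← Finset.sum_add_distrib, ← Finset.sum_add_distrib]
  rw [Finset.mul_sum] at t
  have : 2 * (e 0 + ∑ i ∈ Finset.range (K + 1), ((J : ℝ) + 1) * ((((K : ℝ) + 1) ^ 4 * h i / ((i : ℝ) + 1) ^ 3
      + ((J : ℝ) + 1) ^ 2 * e i / ((i : ℝ) + 1) ^ 2) * kerb ((J : ℝ) + 1) (i + 1))) = 0 := by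
    rw [t]; ring
  rw [← this, mul_add, Finset.mul_sum]
  congr 1
  refine Finset.sum_congr rfl fun i _ => ?_
  ring

lemma lam_eq2 (he : ∀ l : ℕ, e (l + 1) = e l + ((K + 1 : ℕ) : ℝ) ^ 4 * h l / ((l : ℝ) + 1) ^ 3)
    (hh : ∀ l : ℕ, h (l + 1) = h l + e l / ((l : ℝ) + 1))
    (hz : e K + ((K : ℝ) + 1) * h K = 0) (J : ℕ) (hJ : K + 1 ≤ J) :
    ((J : ℝ) + 1) ^ 2 * (lamK (K + 1) e h (J + 1) - lamK (K + 1) e h J)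
      + ((K + 1 : ℕ) : ℝ) ^ 2 * (kapK (K + 1) e (J + 1) - kapK (K + 1) e J)
      = 2 * ((K + 1 : ℕ) : ℝ) ^ 2 * h 0 / ((J : ℝ) + 1) := by
  have t := tele_h e h hh (J + 1) (K + 1) (by omega) (by omega)
  rw [(eh_zero K e h he hh hz).2] at t
  rw [lamK_succ _ _ _ _ hJ, kapK_succ _ _ _ hJ, lamK, kapK]
  push_cast at t ⊢
  rw [add_sub_add_left_eq_sub, ← Finset.sum_sub_distrib, ← Finset.sum_sub_distrib, Finset.mul_sum,
    Finset.mul_sum, ← Finset.sum_add_distrib]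
  have : 2 * ((K : ℝ) + 1) ^ 2 * h 0 / ((J : ℝ) + 1) = - 2 * ((K : ℝ) + 1) ^ 2 * (
    ∑ l ∈ Finset.range (K + 1), (((J : ℝ) + 1) ^ 2 * h l / ((l : ℝ) + 1) ^ 2
      + e l / ((l : ℝ) + 1)) * kerb ((J : ℝ) + 1) (l + 1)) := by
    rw [t]; ring
  rw [this, Finset.mul_sum]
  refine Finset.sum_congr rfl fun i _ => ?_
  have h1 : (i : ℝ) + 1 ≠ 0 := by positivity
  field_simp
  ring

lemma lam_bdry (he : ∀ l : ℕ, e (l + 1) = e l + ((K + 1 : ℕ) : ℝ) ^ 4 * h l / ((l : ℝ) + 1) ^ 3)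
    (hh : ∀ l : ℕ, h (l + 1) = h l + e l / ((l : ℝ) + 1))
    (hz : e K + ((K : ℝ) + 1) * h K = 0) :
    lamK (K + 1) e h (K + 1) + kapK (K + 1) e (K + 1)
      = h 0 / ((K : ℝ) + 1) + 2 * e K * kerb ((K + 1 : ℕ) : ℝ) K / ((K : ℝ) + 1) := by
  have t1 := tele_e (K + 1) e h he (K + 1) K (by omega) (by omega)
  have t2 := tele_h e h hh (K + 1) K (by omega) (by omega)
  have hk : (K : ℝ) + 1 ≠ 0 := by positivity
  have hK : h K = - e K / ((K : ℝ) + 1) := by field_simp; linarith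
  rw [lamK, kapK, add_assoc, ← Finset.sum_add_distrib, Finset.sum_range_succ]
  have hlast : ∀ X : ℝ, ((K + 1 : ℕ) : ℝ) ^ 2 * h K / ((K : ℝ) + 1) ^ 3 * X + e K / ((K : ℝ) + 1) ^ 2 * X = 0 := by
    intro X; rw [hK]; push_cast; field_simp; ring
  rw [hlast, add_zero]
  have hs : ∑ x ∈ Finset.range K, (((K + 1 : ℕ) : ℝ) ^ 2 * h x / ((x : ℝ) + 1) ^ 3 *
          ((((K + 1 : ℕ) : ℝ) + 1 + ((x : ℝ) + 1)) * kerb (((K + 1 : ℕ) : ℝ) + 1) (x + 1)) +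
        e x / ((x : ℝ) + 1) ^ 2 * ((((K + 1 : ℕ) : ℝ) + 1 + ((x : ℝ) + 1)) * kerb (((K + 1 : ℕ) : ℝ) + 1) (x + 1)))
      = (∑ l ∈ Finset.range K, (((K + 1 : ℕ) : ℝ) ^ 4 * h l / ((l : ℝ) + 1) ^ 3
      + ((K + 1 : ℕ) : ℝ) ^ 2 * e l / ((l : ℝ) + 1) ^ 2) * kerb ((K + 1 : ℕ) : ℝ) (l + 1)) / ((K : ℝ) + 1)
      - ∑ l ∈ Finset.range K, (((K + 1 : ℕ) : ℝ) ^ 2 * h l / ((l : ℝ) + 1) ^ 2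
      + e l / ((l : ℝ) + 1)) * kerb ((K + 1 : ℕ) : ℝ) (l + 1) := by
    rw [Finset.sum_div, ← Finset.sum_sub_distrib]
    refine Finset.sum_congr rfl fun i hi => ?_
    have sh := kerb_shift (K + 1) (i + 1) (by have := Finset.mem_range.1 hi; omega)
    have h1 : (i : ℝ) + 1 ≠ 0 := by positivity
    push_cast at sh ⊢
    rw [sh]
    field_simp
  rw [hs, t2]
  have t3 : (∑ l ∈ Finset.range K, (((K + 1 : ℕ) : ℝ) ^ 4 * h l / ((l : ℝ) + 1) ^ 3
      + ((K + 1 : ℕ) : ℝ) ^ 2 * e l / ((l : ℝ) + 1) ^ 2) * kerb ((K + 1 : ℕ) : ℝ) (l + 1))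
      = (((K + 1 : ℕ) : ℝ) * e K * kerb ((K + 1 : ℕ) : ℝ) K - e 0) / ((K + 1 : ℕ) : ℝ) := by
    rw [← t1]; push_cast; field_simp; ring
  rw [t3, hK]
  push_cast
  field_simp
  ring

lemma kerb_kerB (K : ℕ) : kerb ((K + 1 : ℕ) : ℝ) K * ((K : ℝ) + 1)
    = 2 * (-1) ^ K * kerB (K + 1) (K + 1) := by
  have h1 := kerb_fact (K + 1) K (by omega)
  have h2 := kerB_fact (K + 1) (K + 1) le_rfl
  have e1 : K + 1 + (K + 1) = (K + 1 + K) + 1 := by omega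
  have e2 : K + 1 - K - 1 = 0 := by omega
  rw [e1, Nat.factorial_succ, Nat.factorial_succ K, Nat.sub_self] at h2
  rw [e2] at h1
  have f1 : ((K + 1 + K).factorial : ℝ) ≠ 0 := by positivity
  have hk : (K : ℝ) + 1 ≠ 0 := by positivity
  apply mul_right_cancel₀ f1
  apply mul_right_cancel₀ hk
  push_cast [Nat.factorial_zero] at h1 h2 ⊢
  linear_combination ((K : ℝ) + 1) ^ 2 * h1 - (-1) ^ K * h2

lemma sum_lam (he : ∀ l : ℕ, e (l + 1) = e l + ((K + 1 : ℕ) : ℝ) ^ 4 * h l / ((l : ℝ) + 1) ^ 3)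
    (hh : ∀ l : ℕ, h (l + 1) = h l + e l / ((l : ℝ) + 1))
    (hz : e K + ((K : ℝ) + 1) * h K = 0) (J : ℕ) (hJ : K + 1 ≤ J) :
    ∑ j ∈ Finset.range J, h 0 * (seqQ (K + 1) (j + 1) + seqQ (K + 1) j) / ((j : ℝ) + 1)
      = lamK (K + 1) e h J * seqA (K + 1) J + kapK (K + 1) e J * seqQ (K + 1) J
        - 4 * (-1) ^ K * e K := by
  have hk : (K : ℝ) + 1 ≠ 0 := by positivity
  induction J, hJ using Nat.le_induction with
  | base =>
    rw [Finset.sum_range_succ, Finset.sum_eq_zero, zero_add]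
    · rw [seqQ_lt _ _ (Nat.lt_succ_self K), add_zero, seqQ_self, ← add_mul, lam_bdry K e h he hh hz]
      have hB : kerB (K + 1) (K + 1) ≠ 0 := (kerB_pos _ _ le_rfl).ne'
      have hb := kerb_kerB K
      rw [seqA_self _ (by omega)]
      have : kerb ((K + 1 : ℕ) : ℝ) K = 2 * (-1) ^ K * kerB (K + 1) (K + 1) / ((K : ℝ) + 1) := by
        field_simp; linarith
      rw [this]
      push_cast
      field_simp
      ring
    · intro j hj
      have := Finset.mem_range.1 hj
      rw [seqQ_lt _ _ (by omega), seqQ_lt _ _ (by omega)]; simp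
  | succ J hJ ih =>
    rw [Finset.sum_range_succ, ih]
    obtain ⟨r1, r2⟩ := seqA_rel (K + 1) J (by omega)
    have q1 := lam_eq1 K e h he hh hz J hJ
    have q2 := lam_eq2 K e h he hh hz J hJ
    have hk' : ((K + 1 : ℕ) : ℝ) ^ 2 ≠ 0 := by positivity
    apply mul_left_cancel₀ hk'
    have hJ0 : (J : ℝ) + 1 ≠ 0 := by positivity
    have q2' : 2 * ((K + 1 : ℕ) : ℝ) ^ 2 * h 0 / ((J : ℝ) + 1) = 2 * ((K + 1 : ℕ) : ℝ) ^ 2 * (h 0 / ((J : ℝ) + 1)) := by ring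
    have q3 : h 0 * (seqQ (K + 1) (J + 1) + seqQ (K + 1) J) / ((J : ℝ) + 1)
      = (h 0 / ((J : ℝ) + 1)) * (seqQ (K + 1) (J + 1) + seqQ (K + 1) J) := by ring
    rw [q2'] at q2
    rw [q3]
    generalize h 0 / ((J : ℝ) + 1) = u at *
    linear_combination (-(seqA (K + 1) (J + 1) - seqA (K + 1) J) / 2) * q1
      - (kapK (K + 1) e (J + 1) + kapK (K + 1) e J) / 2 * r2
      - (lamK (K + 1) e h (J + 1) - lamK (K + 1) e h J) / 2 * r1
      - (seqQ (K + 1) (J + 1) + seqQ (K + 1) J) / 2 * q2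

/-- The coefficient sequence. -/
noncomputable def xseq (j : ℕ) : ℝ :=
  h 0 * (seqQ (K + 1) (j + 1) + seqQ (K + 1) j) / ((j : ℝ) + 1) / ((K : ℝ) + 1) ^ 4
    - e 0 * (seqA (K + 1) (j + 1) - seqA (K + 1) j) / ((K : ℝ) + 1) ^ 6

lemma kerb_tendsto' (l : ℕ) :
    Tendsto (fun J : ℕ => ((J : ℝ) + 1 + (l + 1)) * kerb ((J : ℝ) + 1) (l + 1)) atTop (𝓝 0) := by
  have h1 := kerb_tendsto l
  have h2 : Tendsto (fun J : ℕ => ((J : ℝ) + 1)⁻¹) atTop (𝓝 0) :=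
    tendsto_inv_atTop_zero.comp (tendsto_atTop_add_const_right _ _ tendsto_natCast_atTop_atTop)
  have h3 := h1.add ((h1.mul h2).const_mul ((l : ℝ) + 1))
  simp only [mul_zero, add_zero] at h3
  refine h3.congr fun J => ?_
  have hJ0 : (J : ℝ) + 1 ≠ 0 := by positivity
  field_simp

lemma bdd_mul_tendsto {u v : ℕ → ℝ} (C : ℝ) (hu : Tendsto u atTop (𝓝 0)) (hv : ∀ n, |v n| ≤ C) :
    Tendsto (fun n => u n * v n) atTop (𝓝 0) := by
  apply squeeze_zero_norm (a := fun n => |u n| * C)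
  · intro n
    rw [Real.norm_eq_abs, abs_mul]
    exact mul_le_mul_of_nonneg_left (hv n) (abs_nonneg _)
  · simpa using hu.abs.mul_const C

lemma xseq_sum (he : ∀ l : ℕ, e (l + 1) = e l + ((K + 1 : ℕ) : ℝ) ^ 4 * h l / ((l : ℝ) + 1) ^ 3)
    (hh : ∀ l : ℕ, h (l + 1) = h l + e l / ((l : ℝ) + 1))
    (hz : e K + ((K : ℝ) + 1) * h K = 0) :
    Tendsto (fun J => ∑ j ∈ Finset.range J, xseq K e h j) atTop
      (𝓝 (- 4 * (-1) ^ K * e K / ((K : ℝ) + 1) ^ 4)) := by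
  have hk : (K : ℝ) + 1 ≠ 0 := by positivity
  have l1 : Tendsto (fun J => lamK (K + 1) e h J - e 0 / ((K + 1 : ℕ) : ℝ) ^ 2) atTop (𝓝 0) := by
    simp only [lamK, add_sub_cancel_left]
    rw [← Finset.sum_const_zero (s := Finset.range (K + 1))]
    refine tendsto_finsetSum _ fun l _ => ?_
    simpa using (kerb_tendsto' l).const_mul (((K + 1 : ℕ) : ℝ) ^ 2 * h l / ((l : ℝ) + 1) ^ 3)
  have l2 : Tendsto (fun J => kapK (K + 1) e J) atTop (𝓝 0) := by
    simp only [kapK]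
    rw [← Finset.sum_const_zero (s := Finset.range (K + 1))]
    refine tendsto_finsetSum _ fun l _ => ?_
    simpa using (kerb_tendsto' l).const_mul (e l / ((l : ℝ) + 1) ^ 2)
  have m1 := bdd_mul_tendsto (seqA (K + 1) (K + 1)) l1 (seqA_bound (K + 1) (by omega))
  have m2 := bdd_mul_tendsto (seqA (K + 1) (K + 1)) l2 (seqQ_bound (K + 1) (by omega))
  have m3 := ((m1.add m2).sub_const (4 * (-1) ^ K * e K)).div_const (((K : ℝ) + 1) ^ 4)
  have e0 : (0 + 0 - 4 * (-1) ^ K * e K) / ((K : ℝ) + 1) ^ 4 = - 4 * (-1) ^ K * e K / ((K : ℝ) + 1) ^ 4 := by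
    ring
  rw [e0] at m3
  refine m3.congr' ?_
  filter_upwards [eventually_ge_atTop (K + 1)] with J hJ
  have s1 := sum_lam K e h he hh hz J hJ
  simp only [xseq]
  rw [Finset.sum_sub_distrib, ← Finset.sum_div, s1, ← Finset.sum_div, ← Finset.mul_sum,
    Finset.sum_range_sub, seqA_lt (K + 1) 0 (by omega)]
  push_cast
  field_simp
  ring

lemma xseq_bound : ∃ C : ℝ, ∀ j, |xseq K e h j| ≤ C / ((j : ℝ) + 1) ^ 2 := by
  set A := seqA (K + 1) (K + 1)
  have hk : (0 : ℝ) < (K : ℝ) + 1 := by positivity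
  refine ⟨|h 0| * (2 * A) * ((K : ℝ) + 1) ^ 2 / ((K : ℝ) + 1) ^ 4
    + |e 0| * (2 * A) * ((K : ℝ) + 1) ^ 2 / ((K : ℝ) + 1) ^ 6, fun j => ?_⟩
  obtain ⟨r1, r2⟩ := seqA_rel (K + 1) j (by omega)
  have hj : (0 : ℝ) < (j : ℝ) + 1 := by positivity
  have hj1 : (1 : ℝ) ≤ (j : ℝ) + 1 := by linarith [(Nat.cast_nonneg j : (0 : ℝ) ≤ j)]
  have a1 := abs_le.1 (seqA_bound (K + 1) (by omega) j)
  have a2 := abs_le.1 (seqA_bound (K + 1) (by omega) (j + 1))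
  have b1 := abs_le.1 (seqQ_bound (K + 1) (by omega) j)
  have b2 := abs_le.1 (seqQ_bound (K + 1) (by omega) (j + 1))
  push_cast at r1 r2
  have e1 : seqQ (K + 1) (j + 1) + seqQ (K + 1) j
    = ((K : ℝ) + 1) ^ 2 * (seqA (K + 1) (j + 1) + seqA (K + 1) j) / ((j : ℝ) + 1) ^ 2 := by
    rw [r1]; field_simp
  have e2 : seqA (K + 1) (j + 1) - seqA (K + 1) j
    = ((K : ℝ) + 1) ^ 2 * (seqQ (K + 1) (j + 1) - seqQ (K + 1) j) / ((j : ℝ) + 1) ^ 2 := by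
    rw [r2]; field_simp
  have c1 : |seqA (K + 1) (j + 1) + seqA (K + 1) j| ≤ 2 * A := by
    rw [abs_le]; constructor <;> linarith [a1.1, a1.2, a2.1, a2.2]
  have c2 : |seqQ (K + 1) (j + 1) - seqQ (K + 1) j| ≤ 2 * A := by
    rw [abs_le]; constructor <;> linarith [b1.1, b1.2, b2.1, b2.2]
  have hA : 0 ≤ 2 * A := le_trans (abs_nonneg _) c1
  rw [xseq, e1, e2]
  refine (abs_sub _ _).trans ?_
  rw [add_div]
  apply add_le_add
  · rw [abs_div, abs_div, abs_mul, abs_div, abs_mul, abs_of_pos hj, abs_of_pos (pow_pos hj 2),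
      abs_of_pos (pow_pos hk 2), abs_of_pos (pow_pos hk 4)]
    have : |h 0| * (((K : ℝ) + 1) ^ 2 * |seqA (K + 1) (j + 1) + seqA (K + 1) j| / ((j : ℝ) + 1) ^ 2) / ((j : ℝ) + 1) / ((K : ℝ) + 1) ^ 4
      = |h 0| * |seqA (K + 1) (j + 1) + seqA (K + 1) j| * ((K : ℝ) + 1) ^ 2 / ((K : ℝ) + 1) ^ 4 / ((j : ℝ) + 1) ^ 2 / ((j : ℝ) + 1) := by
      ring
    rw [this]
    refine (div_le_self (by positivity) hj1).trans ?_
    gcongr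
  · rw [abs_div, abs_mul, abs_div, abs_mul, abs_of_pos (pow_pos hj 2),
      abs_of_pos (pow_pos hk 2), abs_of_pos (pow_pos hk 6)]
    have : |e 0| * (((K : ℝ) + 1) ^ 2 * |seqQ (K + 1) (j + 1) - seqQ (K + 1) j| / ((j : ℝ) + 1) ^ 2) / ((K : ℝ) + 1) ^ 6
      = |e 0| * |seqQ (K + 1) (j + 1) - seqQ (K + 1) j| * ((K : ℝ) + 1) ^ 2 / ((K : ℝ) + 1) ^ 6 / ((j : ℝ) + 1) ^ 2 := by
      ring
    rw [this]
    gcongr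

lemma xseq_kerB (he : ∀ l : ℕ, e (l + 1) = e l + ((K + 1 : ℕ) : ℝ) ^ 4 * h l / ((l : ℝ) + 1) ^ 3)
    (hh : ∀ l : ℕ, h (l + 1) = h l + e l / ((l : ℝ) + 1))
    (hz : e K + ((K : ℝ) + 1) * h K = 0) :
    Tendsto (fun N => ∑ j ∈ Finset.range N, xseq K e h j * kerB N (j + 1)) atTop
      (𝓝 (- 4 * (-1) ^ K * e K / ((K : ℝ) + 1) ^ 4)) := by
  obtain ⟨C, hC⟩ := xseq_bound K e h
  have hsum : Summable fun j : ℕ => C / ((j : ℝ) + 1) ^ 2 := by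
    have := (summable_nat_add_iff 1).2 (Real.summable_one_div_nat_pow.2 (one_lt_two))
    have := this.mul_left C
    refine this.congr fun j => ?_
    push_cast; ring
  have hx : Summable (xseq K e h) := hsum.of_norm_bounded hC
  have hlim := tendsto_nhds_unique hx.hasSum.tendsto_sum_nat (xseq_sum K e h he hh hz)
  rw [← hlim]
  have := tendsto_tsum_of_dominated_convergence (𝓕 := atTop)
    (f := fun N j => xseq K e h j * kerB N (j + 1)) (g := xseq K e h) hsum
    (fun j => by simpa using (kerB_tendsto (j + 1)).const_mul (xseq K e h j))
    (Eventually.of_forall fun N j => by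
      rw [Real.norm_eq_abs, abs_mul, abs_of_nonneg (kerB_mem N (j + 1)).1]
      exact (mul_le_of_le_one_right (abs_nonneg _) (kerB_mem N (j + 1)).2).trans (hC j))
  refine this.congr fun N => ?_
  rw [tsum_eq_sum]
  intro j hj
  rw [kerB_eq_zero, mul_zero]
  have := Finset.mem_range.not.1 hj
  omega

end transport2

/-- The pair of (non-star) generating polynomials. -/
noncomputable def pp (α β : ℝ) : ℕ → Polynomial ℝ × Polynomial ℝ
  | 0 => (Polynomial.C α, Polynomial.C β)
  | N + 1 => ((pp α β N).1 + Polynomial.X * (pp α β N).2 * Polynomial.C (1 / ((N : ℝ) + 1) ^ 3),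
      (pp α β N).2 + (pp α β N).1 * Polynomial.C (1 / ((N : ℝ) + 1)))

noncomputable def va (α β y : ℝ) (N : ℕ) : ℝ := (pp α β N).1.eval y
noncomputable def vb (α β y : ℝ) (N : ℕ) : ℝ := (pp α β N).2.eval y

lemma va_zero (α β y : ℝ) : va α β y 0 = α := by simp [va, pp]
lemma vb_zero (α β y : ℝ) : vb α β y 0 = β := by simp [vb, pp]
lemma va_succ (α β y : ℝ) (N : ℕ) :
    va α β y (N + 1) = va α β y N + y * vb α β y N / ((N : ℝ) + 1) ^ 3 := by
  simp [va, vb, pp]; ring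
lemma vb_succ (α β y : ℝ) (N : ℕ) :
    vb α β y (N + 1) = vb α β y N + va α β y N / ((N : ℝ) + 1) := by
  simp [va, vb, pp]; ring

noncomputable def Dd (N K : ℕ) : ℝ :=
  ∏ i ∈ (Finset.range N).erase K, (1 - ((K : ℝ) + 1) ^ 4 / ((i : ℝ) + 1) ^ 4)

lemma rho_ne (K i : ℕ) (h : i ≠ K) : 1 - ((K : ℝ) + 1) ^ 4 / ((i : ℝ) + 1) ^ 4 ≠ 0 := by
  have hi : (0 : ℝ) < (i : ℝ) + 1 := by positivity
  intro h0
  have h1 : ((K : ℝ) + 1) ^ 4 = ((i : ℝ) + 1) ^ 4 := by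
    field_simp at h0; linarith
  have h2 : (K : ℝ) + 1 = (i : ℝ) + 1 :=
    (pow_left_inj₀ (by positivity) (by positivity) (by norm_num)).1 h1
  apply h
  have : (K : ℝ) = i := by linarith
  exact_mod_cast this.symm

lemma Dd_ne (N K : ℕ) : Dd N K ≠ 0 := by
  rw [Dd, Finset.prod_ne_zero_iff]
  intro i hi
  exact rho_ne K i (Finset.ne_of_mem_erase hi)

lemma Dd_succ (N K : ℕ) (h : N ≠ K) :
    Dd (N + 1) K = Dd N K * (1 - ((K : ℝ) + 1) ^ 4 / ((N : ℝ) + 1) ^ 4) := by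
  rw [Dd, Dd, Finset.range_add_one, Finset.erase_insert_of_ne h, Finset.prod_insert, mul_comm]
  simp

noncomputable def uu (α β : ℝ) (N K : ℕ) : ℝ :=
  if K < N then va α β (((K : ℝ) + 1) ^ 4) N / Dd N K else 0
noncomputable def vv (α β : ℝ) (N K : ℕ) : ℝ :=
  if K < N then vb α β (((K : ℝ) + 1) ^ 4) N / Dd N K else 0

lemma uv_rec (α β : ℝ) (N K : ℕ) :
    vv α β (N + 1) K - vv α β N K = uu α β (N + 1) K / ((N : ℝ) + 1) ∧
    uu α β (N + 1) K - uu α β N K = ((K : ℝ) + 1) ^ 4 * vv α β (N + 1) K / ((N : ℝ) + 1) ^ 3 := by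
  have hN : (N : ℝ) + 1 ≠ 0 := by positivity
  rcases lt_trichotomy K N with h | h | h
  · have hr := rho_ne K N (by omega)
    have hD := Dd_ne N K
    simp only [uu, vv, if_pos h, if_pos (Nat.lt_succ_of_lt h)]
    rw [Dd_succ N K (by omega), va_succ, vb_succ]
    generalize va α β (((K : ℝ) + 1) ^ 4) N = a
    generalize vb α β (((K : ℝ) + 1) ^ 4) N = b
    generalize hρ : 1 - ((K : ℝ) + 1) ^ 4 / ((N : ℝ) + 1) ^ 4 = ρ at *
    have hy : ((K : ℝ) + 1) ^ 4 = ((N : ℝ) + 1) ^ 4 * (1 - ρ) := by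
      rw [← hρ]; field_simp; ring
    rw [hy]
    constructor <;> field_simp <;> ring
  · subst h
    have hD := Dd_ne (K + 1) K
    simp only [uu, vv, lt_irrefl, if_false, if_pos (Nat.lt_succ_self K)]
    rw [va_succ, vb_succ]
    constructor <;> field_simp <;> ring
  · simp only [uu, vv, if_neg (show ¬ K < N by omega), if_neg (show ¬ K < N + 1 by omega)]
    simp

noncomputable def phT (K N : ℕ) : ℝ :=
  ∑ j ∈ Finset.range N, (seqA (K + 1) (j + 1) / ((K : ℝ) + 1) ^ 2 - seqA (K + 1) j / ((K : ℝ) + 1) ^ 2)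
    * kerB N (j + 1)
noncomputable def gaT (K N : ℕ) : ℝ :=
  ∑ j ∈ Finset.range N, (seqQ (K + 1) (j + 1) + seqQ (K + 1) j) * ((j : ℝ) + 1) / ((K : ℝ) + 1) ^ 4
    * kerB N (j + 1)

lemma ker_diff (x : ℕ → ℝ) (N : ℕ) :
    ∑ j ∈ Finset.range (N + 1), x j * kerB (N + 1) (j + 1) - ∑ j ∈ Finset.range N, x j * kerB N (j + 1)
      = (∑ j ∈ Finset.range (N + 1), x j * ((j : ℝ) + 1) ^ 2 * kerB (N + 1) (j + 1)) / ((N : ℝ) + 1) ^ 2 := by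
  have h1 : ∑ j ∈ Finset.range N, x j * kerB N (j + 1) = ∑ j ∈ Finset.range (N + 1), x j * kerB N (j + 1) := by
    rw [Finset.sum_range_succ, kerB_eq_zero N (N + 1) (by omega)]; simp
  rw [h1, ← Finset.sum_sub_distrib, Finset.sum_div]
  refine Finset.sum_congr rfl fun j _ => ?_
  have hN : (N : ℝ) + 1 ≠ 0 := by positivity
  have := kerB_step N (j + 1)
  push_cast at this
  field_simp
  linear_combination (-x j) * this

lemma gaT_rec (K N : ℕ) : gaT K (N + 1) - gaT K N = phT K (N + 1) / ((N : ℝ) + 1) := by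
  have hN : (N : ℝ) + 1 ≠ 0 := by positivity
  have hk : (K : ℝ) + 1 ≠ 0 := by positivity
  have hp := kerB_parts (fun j => seqA (K + 1) j / ((K : ℝ) + 1) ^ 2)
    (by rw [seqA_lt _ _ (by omega)]; simp) (N + 1)
  rw [gaT, gaT, ker_diff (fun j => (seqQ (K + 1) (j + 1) + seqQ (K + 1) j) * ((j : ℝ) + 1) / ((K : ℝ) + 1) ^ 4)]
  have : ∑ j ∈ Finset.range (N + 1), (seqQ (K + 1) (j + 1) + seqQ (K + 1) j) * ((j : ℝ) + 1) / ((K : ℝ) + 1) ^ 4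
      * ((j : ℝ) + 1) ^ 2 * kerB (N + 1) (j + 1) = ((N + 1 : ℕ) : ℝ) * phT K (N + 1) := by
    rw [phT, ← hp]
    refine Finset.sum_congr rfl fun j _ => ?_
    have r := (seqA_rel (K + 1) j (by omega)).1
    push_cast at r
    field_simp
    linear_combination (-(kerB (N + 1) (j + 1))) * r
  rw [this]
  push_cast
  field_simp

lemma phT_rec (K N : ℕ) :
    phT K (N + 1) - phT K N = ((K : ℝ) + 1) ^ 4 * gaT K (N + 1) / ((N : ℝ) + 1) ^ 3 := by
  have hN : (N : ℝ) + 1 ≠ 0 := by positivity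
  have hk : (K : ℝ) + 1 ≠ 0 := by positivity
  have hp := kerB_parts (fun j => seqQ (K + 1) j) (seqQ_lt _ _ (by omega)) (N + 1)
  rw [phT, phT, ker_diff (fun j => seqA (K + 1) (j + 1) / ((K : ℝ) + 1) ^ 2 - seqA (K + 1) j / ((K : ℝ) + 1) ^ 2)]
  have h1 : ∑ j ∈ Finset.range (N + 1), (seqA (K + 1) (j + 1) / ((K : ℝ) + 1) ^ 2 - seqA (K + 1) j / ((K : ℝ) + 1) ^ 2)
      * ((j : ℝ) + 1) ^ 2 * kerB (N + 1) (j + 1) =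
      ∑ j ∈ Finset.range (N + 1), (seqQ (K + 1) (j + 1) - seqQ (K + 1) j) * kerB (N + 1) (j + 1) := by
    refine Finset.sum_congr rfl fun j _ => ?_
    have r := (seqA_rel (K + 1) j (by omega)).2
    push_cast at r
    field_simp
    linear_combination (-(kerB (N + 1) (j + 1))) * r
  have h2 : ((K : ℝ) + 1) ^ 4 * gaT K (N + 1)
      = ∑ j ∈ Finset.range (N + 1), ((j : ℝ) + 1) * (seqQ (K + 1) (j + 1) + seqQ (K + 1) j) * kerB (N + 1) (j + 1) := by
    rw [gaT, Finset.mul_sum]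
    refine Finset.sum_congr rfl fun j _ => ?_
    field_simp
  rw [h1, h2, hp]
  push_cast
  field_simp

lemma phT_zero (K N : ℕ) (h : N ≤ K) : phT K N = 0 := by
  rw [phT]
  refine Finset.sum_eq_zero fun j hj => ?_
  have := Finset.mem_range.1 hj
  rw [seqA_lt _ _ (by omega), seqA_lt _ _ (by omega)]; simp

lemma gaT_zero (K N : ℕ) (h : N ≤ K) : gaT K N = 0 := by
  rw [gaT]
  refine Finset.sum_eq_zero fun j hj => ?_
  have := Finset.mem_range.1 hj
  rw [seqQ_lt _ _ (by omega), seqQ_lt _ _ (by omega)]; simp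

lemma phT_self (K : ℕ) : phT K (K + 1) = 1 := by
  have hk : (K : ℝ) + 1 ≠ 0 := by positivity
  have hB : kerB (K + 1) (K + 1) ≠ 0 := (kerB_pos _ _ le_rfl).ne'
  rw [phT, Finset.sum_range_succ, Finset.sum_eq_zero, seqA_lt _ K (by omega), seqA_self _ (by omega)]
  · push_cast; field_simp; ring
  · intro j hj
    have := Finset.mem_range.1 hj
    rw [seqA_lt _ _ (by omega), seqA_lt _ _ (by omega)]; simp

lemma uv_eq (α β : ℝ) (N K : ℕ) :
    uu α β N K = uu α β (K + 1) K * phT K N ∧ vv α β N K = uu α β (K + 1) K * gaT K N := by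
  rcases Nat.lt_or_ge K N with h | h
  · induction N, (show K + 1 ≤ N from h) using Nat.le_induction with
    | base =>
      have r := (uv_rec α β K K).1
      have r2 := gaT_rec K K
      rw [gaT_zero K K le_rfl, phT_self] at r2
      rw [vv, vv, if_neg (lt_irrefl K), ← vv] at r
      · rw [phT_self, mul_one]
        refine ⟨rfl, ?_⟩
        rw [sub_zero] at r r2
        rw [r, r2]; ring
    | succ N hN ih =>
      obtain ⟨i1, i2⟩ := ih hN
      obtain ⟨r1, r2⟩ := uv_rec α β N K
      have s1 := gaT_rec K N
      have s2 := phT_rec K N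
      have hN0 : (N : ℝ) + 1 ≠ 0 := by positivity
      have hr := rho_ne K N (by omega)
      generalize hσ : uu α β (K + 1) K = σ at *
      rw [i1] at r2
      rw [i2] at r1
      have hv : vv α β (N + 1) K = σ * gaT K N + uu α β (N + 1) K / ((N : ℝ) + 1) := by linarith
      have hg : gaT K (N + 1) = gaT K N + phT K (N + 1) / ((N : ℝ) + 1) := by linarith
      have hu : uu α β (N + 1) K = σ * phT K (N + 1) := by
        apply mul_right_cancel₀ hr
        rw [hv] at r2
        rw [hg] at s2
        have e1 : ∀ x : ℝ, x * (1 - ((K : ℝ) + 1) ^ 4 / ((N : ℝ) + 1) ^ 4) = x - ((K : ℝ) + 1) ^ 4 * (x / ((N : ℝ) + 1)) / ((N : ℝ) + 1) ^ 3 := by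
          intro x; field_simp
        rw [e1, e1]
        linear_combination r2 - σ * s2
      refine ⟨hu, ?_⟩
      rw [hv, hg, hu]; ring
  · rw [phT_zero _ _ h, gaT_zero _ _ h, uu, vv, if_neg (by omega), if_neg (by omega)]; simp

/-- The coefficient of `1/k^{4n}` in the sum of the two truncated star sums. -/
noncomputable def cc (N K : ℕ) : ℝ :=
  ∑ m ∈ Finset.range N, vv 1 0 (m + 1) K / ((m : ℝ) + 1) ^ 2 + uu 0 1 N K / ((K : ℝ) + 1) ^ 4

lemma ga_sum (K N : ℕ) : ∑ m ∈ Finset.range N, gaT K (m + 1) / ((m : ℝ) + 1) ^ 2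
    = ∑ j ∈ Finset.range N, (seqQ (K + 1) (j + 1) + seqQ (K + 1) j) / ((j : ℝ) + 1) / ((K : ℝ) + 1) ^ 4
      * kerB N (j + 1) := by
  have h1 : ∀ m ∈ Finset.range N, gaT K (m + 1) / ((m : ℝ) + 1) ^ 2 = ∑ j ∈ Finset.range N,
      (seqQ (K + 1) (j + 1) + seqQ (K + 1) j) * ((j : ℝ) + 1) / ((K : ℝ) + 1) ^ 4
        * (kerB (m + 1) (j + 1) / ((m : ℝ) + 1) ^ 2) := by
    intro m hm
    have hm := Finset.mem_range.1 hm
    rw [gaT, Finset.sum_div]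
    rw [← Finset.sum_subset (s₁ := Finset.range (m + 1)) (s₂ := Finset.range N)]
    · refine Finset.sum_congr rfl fun j _ => ?_
      ring
    · intro j hj; rw [Finset.mem_range] at *; omega
    · intro j _ hj
      rw [Finset.mem_range] at hj
      rw [kerB_eq_zero _ _ (by omega)]; simp
  rw [Finset.sum_congr rfl h1, Finset.sum_comm]
  refine Finset.sum_congr rfl fun j _ => ?_
  rw [← Finset.mul_sum, kerB_sum_sq]
  have hj : (j : ℝ) + 1 ≠ 0 := by positivity
  field_simp

lemma wronski (y : ℝ) (l : ℕ) :
    va 1 0 y l * vb 0 1 y l - va 0 1 y l * vb 1 0 y l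
      = ∏ i ∈ Finset.range l, (1 - y / ((i : ℝ) + 1) ^ 4) := by
  induction l with
  | zero => simp [va_zero, vb_zero]
  | succ l ih =>
    rw [Finset.prod_range_succ, ← ih, va_succ, va_succ, vb_succ, vb_succ]
    have hj : (l : ℝ) + 1 ≠ 0 := by positivity
    field_simp
    ring

lemma Dd_self (K : ℕ) : Dd (K + 1) K = ∏ i ∈ Finset.range K, (1 - ((K : ℝ) + 1) ^ 4 / ((i : ℝ) + 1) ^ 4) := by
  rw [Dd, Finset.range_add_one, Finset.erase_insert (by simp)]

lemma cc_tendsto (K : ℕ) :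
    Tendsto (fun N => cc N K) atTop (𝓝 (4 * (-1) ^ K / ((K : ℝ) + 1) ^ 3)) := by
  set y : ℝ := ((K : ℝ) + 1) ^ 4 with hy
  have hk : (K : ℝ) + 1 ≠ 0 := by positivity
  set s := va 1 0 y K + ((K : ℝ) + 1) * vb 1 0 y K with hs
  set t := va 0 1 y K + ((K : ℝ) + 1) * vb 0 1 y K with ht
  set e : ℕ → ℝ := fun l => s * va 0 1 y l - t * va 1 0 y l with he
  set h : ℕ → ℝ := fun l => s * vb 0 1 y l - t * vb 1 0 y l with hh
  have hd := Dd_ne (K + 1) K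
  have lim := xseq_kerB K e h
    (by intro l; simp only [he, hh, va_succ, hy]; push_cast; ring)
    (by intro l; simp only [he, hh, vb_succ]; ring)
    (by simp only [he, hh, hs, ht]; ring)
  have eK : e K = - ((K : ℝ) + 1) * Dd (K + 1) K := by
    rw [Dd_self, ← hy, ← wronski]
    simp only [he, hs, ht]; ring
  have e0 : e 0 = - t := by simp [he, va_zero]
  have h0 : h 0 = s := by simp [hh, vb_zero]
  have us : uu 1 0 (K + 1) K = s / Dd (K + 1) K := by
    rw [uu, if_pos (Nat.lt_succ_self K), va_succ, ← hy, hs]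
    congr 1; rw [hy]; field_simp
  have ut : uu 0 1 (K + 1) K = t / Dd (K + 1) K := by
    rw [uu, if_pos (Nat.lt_succ_self K), va_succ, ← hy, ht]
    congr 1; rw [hy]; field_simp
  have lim2 := lim.div_const (Dd (K + 1) K)
  rw [eK] at lim2
  have ev : -4 * (-1) ^ K * (-((K : ℝ) + 1) * Dd (K + 1) K) / ((K : ℝ) + 1) ^ 4 / Dd (K + 1) K
      = 4 * (-1) ^ K / ((K : ℝ) + 1) ^ 3 := by
    field_simp
  rw [ev] at lim2
  refine lim2.congr fun N => ?_
  rw [cc]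
  have c1 : ∑ m ∈ Finset.range N, vv 1 0 (m + 1) K / ((m : ℝ) + 1) ^ 2
      = s / Dd (K + 1) K * ∑ m ∈ Finset.range N, gaT K (m + 1) / ((m : ℝ) + 1) ^ 2 := by
    rw [Finset.mul_sum]
    refine Finset.sum_congr rfl fun m _ => ?_
    rw [(uv_eq 1 0 (m + 1) K).2, us]; ring
  rw [c1, ga_sum, (uv_eq 0 1 N K).1, ut, phT, Finset.mul_sum, Finset.mul_sum, Finset.sum_div, Finset.sum_div,
    ← Finset.sum_add_distrib]
  refine Finset.sum_congr rfl fun j _ => ?_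
  rw [xseq, e0, h0]
  have hj : (j : ℝ) + 1 ≠ 0 := by positivity
  field_simp
  ring

lemma va_vb_nonneg (α β y : ℝ) (hα : 0 ≤ α) (hβ : 0 ≤ β) (hy : 0 ≤ y) (N : ℕ) :
    0 ≤ va α β y N ∧ 0 ≤ vb α β y N := by
  induction N with
  | zero => rw [va_zero, vb_zero]; exact ⟨hα, hβ⟩
  | succ N ih =>
    obtain ⟨h1, h2⟩ := ih
    rw [va_succ, vb_succ]
    constructor <;> positivity

lemma Dd_sign (N K : ℕ) (h : K + 1 ≤ N) : 0 < (-1 : ℝ) ^ K * Dd N K := by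
  induction N, h using Nat.le_induction with
  | base =>
    have hc : (-1 : ℝ) ^ K = ∏ _i ∈ Finset.range K, (-1 : ℝ) := by simp
    rw [Dd_self, hc, ← Finset.prod_mul_distrib]
    refine Finset.prod_pos fun i hi => ?_
    have hi' : (i : ℝ) + 1 < (K : ℝ) + 1 := by
      have := Finset.mem_range.1 hi
      have : (i : ℝ) < K := by exact_mod_cast this
      linarith
    have hi0 : (0 : ℝ) < (i : ℝ) + 1 := by positivity
    have : 1 < ((K : ℝ) + 1) ^ 4 / ((i : ℝ) + 1) ^ 4 := by
      rw [one_lt_div (by positivity)]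
      gcongr
    linarith
  | succ N hN ih =>
    rw [Dd_succ N K (by omega), ← mul_assoc]
    refine mul_pos ih ?_
    have hi' : (K : ℝ) + 1 < (N : ℝ) + 1 := by
      have : (K : ℝ) < N := by exact_mod_cast hN
      linarith
    have : ((K : ℝ) + 1) ^ 4 / ((N : ℝ) + 1) ^ 4 < 1 := by
      rw [div_lt_one (by positivity)]
      gcongr
    linarith

lemma sign_div (K : ℕ) (a D : ℝ) (ha : 0 ≤ a) (hD : 0 < (-1 : ℝ) ^ K * D) : 0 ≤ (-1 : ℝ) ^ K * (a / D) := by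
  rcases neg_one_pow_eq_or ℝ K with h | h
  · rw [h, one_mul] at hD ⊢; exact div_nonneg ha hD.le
  · rw [h] at hD ⊢
    have : -1 * (a / D) = a / (-1 * D) := by rw [neg_one_mul, neg_one_mul, div_neg]
    rw [this]; exact div_nonneg ha hD.le

lemma uv_sign (α β : ℝ) (hα : 0 ≤ α) (hβ : 0 ≤ β) (N K : ℕ) :
    0 ≤ (-1 : ℝ) ^ K * uu α β N K ∧ 0 ≤ (-1 : ℝ) ^ K * vv α β N K := by
  have := va_vb_nonneg α β (((K : ℝ) + 1) ^ 4) hα hβ (by positivity) N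
  rw [uu, vv]
  split_ifs with h
  · exact ⟨sign_div _ _ _ this.1 (Dd_sign N K h), sign_div _ _ _ this.2 (Dd_sign N K h)⟩
  · simp

lemma cc_zero (N K : ℕ) (h : N ≤ K) : cc N K = 0 := by
  rw [cc, uu, if_neg (by omega), Finset.sum_eq_zero]
  · simp
  · intro m hm
    have := Finset.mem_range.1 hm
    rw [vv, if_neg (by omega), zero_div]

lemma cc_mono (K : ℕ) : Monotone fun N => (-1 : ℝ) ^ K * cc N K := by
  refine monotone_nat_of_le_succ fun N => ?_
  have hk : (K : ℝ) + 1 ≠ 0 := by positivity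
  have h1 : cc (N + 1) K - cc N K = vv 1 0 (N + 1) K / ((N : ℝ) + 1) ^ 2 + vv 0 1 (N + 1) K / ((N : ℝ) + 1) ^ 3 := by
    have := (uv_rec 0 1 N K).2
    rw [cc, cc, Finset.sum_range_succ]
    have h2 : uu 0 1 (N + 1) K = uu 0 1 N K + ((K : ℝ) + 1) ^ 4 * vv 0 1 (N + 1) K / ((N : ℝ) + 1) ^ 3 := by linarith
    rw [h2]
    field_simp
    ring
  have h2 := (uv_sign 1 0 (by norm_num) le_rfl (N + 1) K).2
  have h3 := (uv_sign 0 1 le_rfl (by norm_num) (N + 1) K).2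
  have h4 : 0 ≤ (-1 : ℝ) ^ K * (cc (N + 1) K - cc N K) := by
    rw [h1]
    have : (-1 : ℝ) ^ K * (vv 1 0 (N + 1) K / ((N : ℝ) + 1) ^ 2 + vv 0 1 (N + 1) K / ((N : ℝ) + 1) ^ 3)
      = ((-1 : ℝ) ^ K * vv 1 0 (N + 1) K) / ((N : ℝ) + 1) ^ 2 + ((-1 : ℝ) ^ K * vv 0 1 (N + 1) K) / ((N : ℝ) + 1) ^ 3 := by ring
    rw [this]; positivity
  linarith

lemma cc_bound (N K : ℕ) : |cc N K| ≤ 4 / ((K : ℝ) + 1) ^ 3 := by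
  have hsq : (-1 : ℝ) ^ K * (-1) ^ K = 1 := by rw [← mul_pow]; simp
  have h1 : (-1 : ℝ) ^ K * cc N K ≤ (-1 : ℝ) ^ K * (4 * (-1) ^ K / ((K : ℝ) + 1) ^ 3) :=
    (cc_mono K).ge_of_tendsto ((cc_tendsto K).const_mul _) N
  have h2 : (-1 : ℝ) ^ K * (4 * (-1) ^ K / ((K : ℝ) + 1) ^ 3) = 4 / ((K : ℝ) + 1) ^ 3 := by
    rw [← mul_div_assoc]; congr 1; linear_combination 4 * hsq
  have h0 : 0 ≤ (-1 : ℝ) ^ K * cc N K := by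
    have := cc_mono K (Nat.zero_le N)
    simpa [cc_zero 0 K (Nat.zero_le _)] using this
  have h3 : |cc N K| = (-1 : ℝ) ^ K * cc N K := by
    rw [← abs_of_nonneg h0, abs_mul]; simp
  rw [h3, ← h2]; exact h1

open Polynomial in
lemma lagrange_zero (p : ℝ[X]) (N : ℕ) (hp : p.degree < (N : ℕ)) :
    ∑ K ∈ Finset.range N, p.eval (((K : ℝ) + 1) ^ 4) / Dd N K = p.eval 0 := by
  have hinj : Set.InjOn (fun i : ℕ => ((i : ℝ) + 1) ^ 4) (Finset.range N) := by
    intro i _ j _ hij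
    have h2 : (i : ℝ) + 1 = (j : ℝ) + 1 :=
      (pow_left_inj₀ (by positivity) (by positivity) (by norm_num)).1 hij
    have : (i : ℝ) = j := by linarith
    exact_mod_cast this
  have h := Lagrange.eq_interpolate (f := p) hinj (by simpa using hp)
  conv_rhs => rw [h]
  rw [Lagrange.interpolate_apply, Polynomial.eval_finsetSum]
  refine Finset.sum_congr rfl fun K _ => ?_
  rw [Polynomial.eval_mul, Polynomial.eval_C, div_eq_mul_inv]
  congr 1
  rw [Lagrange.basis, Polynomial.eval_prod, Dd, ← Finset.prod_inv_distrib]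
  refine Finset.prod_congr rfl fun i hi => ?_
  have hne := rho_ne K i (Finset.ne_of_mem_erase hi)
  have hi0 : ((i : ℝ) + 1) ^ 4 ≠ 0 := by positivity
  have e1 : 1 - ((K : ℝ) + 1) ^ 4 / ((i : ℝ) + 1) ^ 4 = - ((((K : ℝ) + 1) ^ 4 - ((i : ℝ) + 1) ^ 4) / ((i : ℝ) + 1) ^ 4) := by
    field_simp; ring
  rw [e1] at hne ⊢
  have hne2 : ((K : ℝ) + 1) ^ 4 - ((i : ℝ) + 1) ^ 4 ≠ 0 := by
    intro h0; rw [h0] at hne; simp at hne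
  simp only [Lagrange.basisDivisor, Polynomial.eval_mul, Polynomial.eval_C, Polynomial.eval_sub, Polynomial.eval_X]
  field_simp
  ring

lemma pp_deg (α β : ℝ) (δ : ℕ) (hδ : δ ≤ 1) (h1 : (pp α β 1).1.natDegree ≤ δ)
    (h2 : (pp α β 1).2.natDegree ≤ 0) (N : ℕ) :
    (pp α β (N + 1)).1.natDegree ≤ N + δ ∧ (pp α β (N + 1)).2.natDegree ≤ N := by
  induction N with
  | zero => exact ⟨by simpa using h1, h2⟩
  | succ N ih =>
    obtain ⟨i1, i2⟩ := ih
    rw [pp]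
    constructor
    · refine (Polynomial.natDegree_add_le _ _).trans (max_le (by omega) ?_)
      refine (Polynomial.natDegree_mul_C_le _ _).trans ?_
      refine Polynomial.natDegree_mul_le.trans ?_
      rw [Polynomial.natDegree_X]; omega
    · refine (Polynomial.natDegree_add_le _ _).trans (max_le (by omega) ?_)
      refine (Polynomial.natDegree_mul_C_le _ _).trans (by omega)

lemma sum_uu (N : ℕ) (hN : 1 ≤ N) : ∑ K ∈ Finset.range N, uu 1 0 N K = 1 := by
  obtain ⟨M, rfl⟩ : ∃ M, N = M + 1 := ⟨N - 1, by omega⟩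
  have hd := (pp_deg 1 0 0 (by omega) (by simp [pp]) (by simp [pp]) M).1
  have hc : ∀ N, va 1 0 0 N = 1 := by
    intro N
    induction N with
    | zero => exact va_zero _ _ _
    | succ N ih => rw [va_succ, ih]; simp
  refine Eq.trans ?_ (hc (M + 1))
  rw [va, ← lagrange_zero _ (M + 1)]
  · refine Finset.sum_congr rfl fun K hK => ?_
    rw [uu, if_pos (Finset.mem_range.1 hK), va]
  · refine lt_of_le_of_lt Polynomial.degree_le_natDegree ?_
    exact_mod_cast (by omega)

lemma sum_vv (N : ℕ) (hN : 1 ≤ N) : ∑ K ∈ Finset.range N, vv 0 1 N K = 1 := by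
  obtain ⟨M, rfl⟩ : ∃ M, N = M + 1 := ⟨N - 1, by omega⟩
  have hd := (pp_deg 0 1 1 le_rfl
    (by simp only [pp]; simp) (by simp [pp]) M).2
  have hc : ∀ N, va 0 1 0 N = 0 ∧ vb 0 1 0 N = 1 := by
    intro N
    induction N with
    | zero => exact ⟨va_zero _ _ _, vb_zero _ _ _⟩
    | succ N ih => rw [va_succ, vb_succ, ih.1, ih.2]; simp
  refine Eq.trans ?_ (hc (M + 1)).2
  rw [vb, ← lagrange_zero _ (M + 1)]
  · refine Finset.sum_congr rfl fun K hK => ?_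
    rw [vv, if_pos (Finset.mem_range.1 hK), vb]
  · refine lt_of_le_of_lt Polynomial.degree_le_natDegree ?_
    exact_mod_cast (by omega)

/-- Summation of a triangular array in its first index. -/
lemma tri_sum (x : ℕ → ℕ → ℝ) (hx : ∀ N K, N ≤ K → x N K = 0) (w : ℕ → ℝ) (N : ℕ) :
    ∑ m ∈ Finset.range N, ∑ K ∈ Finset.range (m + 1), (x (m + 1) K - x m K) * w K
      = ∑ K ∈ Finset.range N, x N K * w K := by
  induction N with
  | zero => simp
  | succ N ih =>
    rw [Finset.sum_range_succ, ih]
    have : ∑ K ∈ Finset.range N, x N K * w K = ∑ K ∈ Finset.range (N + 1), x N K * w K := by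
      rw [Finset.sum_range_succ, hx N N le_rfl]; simp
    rw [this, ← Finset.sum_add_distrib]
    refine Finset.sum_congr rfl fun K _ => ?_
    ring

lemma uu_zero (α β : ℝ) (N K : ℕ) (h : N ≤ K) : uu α β N K = 0 := by rw [uu, if_neg (by omega)]
lemma vv_zero (α β : ℝ) (N K : ℕ) (h : N ≤ K) : vv α β N K = 0 := by rw [vv, if_neg (by omega)]

/-- Truncated multiple zeta star sums. -/
noncomputable def zs (σ : ℕ → ℕ) : ℕ → ℕ → ℝ
  | 0, _ => 1
  | d + 1, N => ∑ m ∈ Finset.range N, zs σ d (m + 1) / ((m : ℝ) + 1) ^ σ d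

lemma sum_v_step (α β : ℝ) (w : ℕ → ℝ) (N : ℕ) :
    ∑ m ∈ Finset.range N, (∑ K ∈ Finset.range (m + 1), uu α β (m + 1) K * w K) / ((m : ℝ) + 1)
      = ∑ K ∈ Finset.range N, vv α β N K * w K := by
  rw [← tri_sum (vv α β) (vv_zero α β)]
  refine Finset.sum_congr rfl fun m _ => ?_
  rw [Finset.sum_div]
  refine Finset.sum_congr rfl fun K _ => ?_
  rw [(uv_rec α β m K).1]; ring

lemma sum_u_step (α β : ℝ) (w : ℕ → ℝ) (N : ℕ) :
    ∑ m ∈ Finset.range N, (∑ K ∈ Finset.range (m + 1), vv α β (m + 1) K * w K) / ((m : ℝ) + 1) ^ 3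
      = ∑ K ∈ Finset.range N, uu α β N K * (w K / ((K : ℝ) + 1) ^ 4) := by
  rw [← tri_sum (uu α β) (uu_zero α β)]
  refine Finset.sum_congr rfl fun m _ => ?_
  rw [Finset.sum_div]
  refine Finset.sum_congr rfl fun K _ => ?_
  have hk : (K : ℝ) + 1 ≠ 0 := by positivity
  rw [(uv_rec α β m K).2]; field_simp

lemma zs_13 (σ : ℕ → ℕ) (i : ℕ) (h1 : ∀ j, j < i → σ (2 * j) = 1) (h3 : ∀ j, j < i → σ (2 * j + 1) = 3)
    (N : ℕ) (hN : 1 ≤ N) :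
    zs σ (2 * i) N = ∑ K ∈ Finset.range N, uu 1 0 N K * (1 / ((K : ℝ) + 1) ^ (4 * i)) := by
  induction i generalizing N with
  | zero => simp [zs, sum_uu N hN]
  | succ i ih =>
    have ih := ih (fun j hj => h1 j (by omega)) (fun j hj => h3 j (by omega))
    have hG : ∀ M, zs σ (2 * i + 1) M = ∑ K ∈ Finset.range M, vv 1 0 M K * (1 / ((K : ℝ) + 1) ^ (4 * i)) := by
      intro M
      rw [zs, h1 i (by omega), ← sum_v_step]
      refine Finset.sum_congr rfl fun m _ => ?_
      rw [ih (m + 1) (by omega), pow_one]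
    rw [show 2 * (i + 1) = (2 * i + 1) + 1 by ring, zs, h3 i (by omega)]
    simp only [hG]
    rw [sum_u_step]
    refine Finset.sum_congr rfl fun K _ => ?_
    rw [show 4 * (i + 1) = 4 * i + 4 by ring, pow_add]
    field_simp

lemma zs_1312 (σ : ℕ → ℕ) (n : ℕ) (h1 : ∀ j, j ≤ n → σ (2 * j) = 1) (h3 : ∀ j, j < n → σ (2 * j + 1) = 3)
    (h2 : σ (2 * n + 1) = 2) (N : ℕ) :
    zs σ (2 * n + 1 + 1) N = ∑ m ∈ Finset.range N,
      (∑ K ∈ Finset.range (m + 1), vv 1 0 (m + 1) K * (1 / ((K : ℝ) + 1) ^ (4 * n))) / ((m : ℝ) + 1) ^ 2 := by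
  have hG : ∀ M, zs σ (2 * n + 1) M = ∑ K ∈ Finset.range M, vv 1 0 M K * (1 / ((K : ℝ) + 1) ^ (4 * n)) := by
    intro M
    rw [zs, h1 n le_rfl, ← sum_v_step]
    refine Finset.sum_congr rfl fun m _ => ?_
    rw [zs_13 σ n (fun j hj => h1 j hj.le) h3 (m + 1) (by omega), pow_one]
  rw [zs, h2]
  simp only [hG]

lemma zs_31 (σ : ℕ → ℕ) (i : ℕ) (h3 : ∀ j, j ≤ i → σ (2 * j) = 3) (h1 : ∀ j, j < i → σ (2 * j + 1) = 1)
    (N : ℕ) :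
    zs σ (2 * i + 1) N = ∑ K ∈ Finset.range N, uu 0 1 N K * (1 / ((K : ℝ) + 1) ^ (4 * i) / ((K : ℝ) + 1) ^ 4) := by
  induction i generalizing N with
  | zero =>
    rw [zs, h3 0 le_rfl, ← sum_u_step]
    refine Finset.sum_congr rfl fun m _ => ?_
    simp [zs, sum_vv (m + 1) (by omega)]
  | succ i ih =>
    have ih := ih (fun j hj => h3 j (by omega)) (fun j hj => h1 j (by omega))
    have hG : ∀ M, zs σ (2 * (i + 1)) M = ∑ K ∈ Finset.range M, vv 0 1 M K * (1 / ((K : ℝ) + 1) ^ (4 * (i + 1))) := by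
      intro M
      rw [show 2 * (i + 1) = (2 * i + 1) + 1 by ring, zs, h1 i (by omega), ← sum_v_step]
      refine Finset.sum_congr rfl fun m _ => ?_
      rw [ih (m + 1), pow_one]
      congr 1
      refine Finset.sum_congr rfl fun K _ => ?_
      rw [show 4 * (i + 1) = 4 * i + 4 by ring, pow_add]
      field_simp
    rw [zs, h3 (i + 1) le_rfl]
    simp only [hG]
    rw [sum_u_step]

lemma zs_add (σ τ : ℕ → ℕ) (n : ℕ) (h1 : ∀ j, j ≤ n → σ (2 * j) = 1) (h3 : ∀ j, j < n → σ (2 * j + 1) = 3)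
    (h2 : σ (2 * n + 1) = 2) (g3 : ∀ j, j ≤ n → τ (2 * j) = 3) (g1 : ∀ j, j < n → τ (2 * j + 1) = 1) (N : ℕ) :
    zs σ (2 * n + 1 + 1) N + zs τ (2 * n + 1) N = ∑ K ∈ Finset.range N, cc N K * (1 / ((K : ℝ) + 1) ^ (4 * n)) := by
  rw [zs_1312 σ n h1 h3 h2, zs_31 τ n g3 g1]
  have : ∀ m ∈ Finset.range N,
      (∑ K ∈ Finset.range (m + 1), vv 1 0 (m + 1) K * (1 / ((K : ℝ) + 1) ^ (4 * n))) / ((m : ℝ) + 1) ^ 2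
      = ∑ K ∈ Finset.range N, vv 1 0 (m + 1) K * (1 / ((K : ℝ) + 1) ^ (4 * n)) / ((m : ℝ) + 1) ^ 2 := by
    intro m hm
    have hm := Finset.mem_range.1 hm
    rw [Finset.sum_div]
    apply Finset.sum_subset
    · intro j hj; rw [Finset.mem_range] at *; omega
    · intro j _ hj
      rw [Finset.mem_range] at hj
      rw [vv_zero _ _ _ _ (by omega)]; simp
  rw [Finset.sum_congr rfl this, Finset.sum_comm, ← Finset.sum_add_distrib]
  refine Finset.sum_congr rfl fun K _ => ?_
  rw [cc, add_mul, Finset.sum_mul]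
  congr 1
  · refine Finset.sum_congr rfl fun m _ => ?_
    ring
  · ring

lemma cc_sum_tendsto (n : ℕ) :
    Tendsto (fun N => ∑ K ∈ Finset.range N, cc N K * (1 / ((K : ℝ) + 1) ^ (4 * n))) atTop
      (𝓝 (∑' K : ℕ, 4 * ((-1) ^ K / ((K : ℝ) + 1) ^ (4 * n + 3)))) := by
  have hsum : Summable fun j : ℕ => 4 / ((j : ℝ) + 1) ^ 3 := by
    have := (summable_nat_add_iff 1).2 (Real.summable_one_div_nat_pow.2 (show 1 < 3 by norm_num))
    have := this.mul_left 4
    refine this.congr fun j => ?_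
    push_cast; ring
  have := tendsto_tsum_of_dominated_convergence (𝓕 := atTop)
    (f := fun N K => cc N K * (1 / ((K : ℝ) + 1) ^ (4 * n)))
    (g := fun K : ℕ => 4 * ((-1) ^ K / ((K : ℝ) + 1) ^ (4 * n + 3))) hsum
    (fun K => by
      have := (cc_tendsto K).mul_const (1 / ((K : ℝ) + 1) ^ (4 * n))
      convert this using 2
      rw [pow_add]; field_simp)
    (Eventually.of_forall fun N K => by
      rw [Real.norm_eq_abs, abs_mul]
      have h1 : |1 / ((K : ℝ) + 1) ^ (4 * n)| ≤ 1 := by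
        rw [abs_of_nonneg (by positivity)]
        apply div_le_one_of_le₀ _ (by positivity)
        apply one_le_pow₀
        linarith [(Nat.cast_nonneg K : (0 : ℝ) ≤ K)]
      exact (mul_le_of_le_one_right (abs_nonneg _) h1).trans (cc_bound N K))
  refine this.congr fun N => ?_
  rw [tsum_eq_sum]
  intro K hK
  have := Finset.mem_range.not.1 hK
  rw [cc_zero _ _ (by omega), zero_mul]

lemma eta_eq (s : ℕ) (hs : 1 < s) :
    ∑' K : ℕ, (-1 : ℝ) ^ K / ((K : ℝ) + 1) ^ s = (1 - 2 / 2 ^ s) * ∑' K : ℕ, 1 / ((K : ℝ) + 1) ^ s := by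
  have hS : Summable fun K : ℕ => 1 / ((K : ℝ) + 1) ^ s := by
    have := (summable_nat_add_iff 1).2 (Real.summable_one_div_nat_pow.2 hs)
    refine this.congr fun j => ?_
    norm_num
  have hS2 : Summable fun K : ℕ => (-1 : ℝ) ^ K / ((K : ℝ) + 1) ^ s := by
    refine hS.of_norm_bounded fun K => ?_
    rw [Real.norm_eq_abs, abs_div, abs_pow, abs_neg, abs_one, one_pow, abs_of_pos (by positivity)]
  have ie : Function.Injective fun k : ℕ => 2 * k := fun a b h => by simpa using h
  have io : Function.Injective fun k : ℕ => 2 * k + 1 := fun a b h => by simpa using h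
  have t1 := tsum_even_add_odd (f := fun K : ℕ => 1 / ((K : ℝ) + 1) ^ s) (hS.comp_injective ie) (hS.comp_injective io)
  have t2 := tsum_even_add_odd (f := fun K : ℕ => (-1 : ℝ) ^ K / ((K : ℝ) + 1) ^ s) (hS2.comp_injective ie) (hS2.comp_injective io)
  have o : ∑' k : ℕ, 1 / (((2 * k + 1 : ℕ) : ℝ) + 1) ^ s = 1 / 2 ^ s * ∑' K : ℕ, 1 / ((K : ℝ) + 1) ^ s := by
    rw [← tsum_mul_left]
    congr 1; ext k
    push_cast
    rw [show (2 * (k : ℝ) + 1 + 1) = 2 * (k + 1) by ring, mul_pow]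
    field_simp
  have o2 : ∑' k : ℕ, (-1 : ℝ) ^ (2 * k + 1) / (((2 * k + 1 : ℕ) : ℝ) + 1) ^ s
      = - ∑' k : ℕ, 1 / (((2 * k + 1 : ℕ) : ℝ) + 1) ^ s := by
    rw [← tsum_neg]
    congr 1; ext k
    rw [pow_succ, pow_mul]; simp
    rw [neg_div, one_div]
  have e2 : ∑' k : ℕ, (-1 : ℝ) ^ (2 * k) / (((2 * k : ℕ) : ℝ) + 1) ^ s
      = ∑' k : ℕ, 1 / (((2 * k : ℕ) : ℝ) + 1) ^ s := by
    congr 1; ext k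
    rw [pow_mul]; simp
  rw [← t2, e2, o2, o]
  rw [o] at t1
  linear_combination t1

lemma idxSeq_castSucc {d : ℕ} (g : Fin (d + 1) → ℕ) (i : Fin d) :
    idxSeq g i.castSucc = idxSeq (fun j : Fin d => g j.castSucc) i := by
  simp only [idxSeq, Finset.sum_filter]
  rw [Fin.sum_univ_castSucc]
  have : ¬ (Fin.last d ≤ i.castSucc) := not_le.2 (Fin.castSucc_lt_last i)
  simp [this]

lemma idxSeq_last {d : ℕ} (g : Fin (d + 1) → ℕ) : idxSeq g (Fin.last d) = 1 + ∑ j, g j := by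
  simp [idxSeq, Fin.le_last]

/-- Gap functions with total gap less than `N`. -/
def gapT (d N : ℕ) : Finset (Fin d → ℕ) :=
  (Fintype.piFinset fun _ => Finset.range N).filter fun g => ∑ j, g j < N

lemma mem_gapT {d N : ℕ} (g : Fin d → ℕ) : g ∈ gapT d N ↔ ∑ j, g j < N := by
  simp only [gapT, Finset.mem_filter, Fintype.mem_piFinset, Finset.mem_range, and_iff_right_iff_imp]
  intro h i
  exact lt_of_le_of_lt (Finset.single_le_sum (f := g) (fun _ _ => Nat.zero_le _) (Finset.mem_univ i)) h

lemma gapT_sum (σ : ℕ → ℕ) (d N : ℕ) (hN : 1 ≤ N) :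
    ∑ g ∈ gapT d N, ∏ i : Fin d, 1 / (idxSeq g i : ℝ) ^ σ i = zs σ d N := by
  induction d generalizing N with
  | zero =>
    have : gapT 0 N = {fun i => i.elim0} := by
      ext g
      rw [mem_gapT, Finset.mem_singleton]
      constructor
      · intro _; exact Subsingleton.elim _ _
      · intro _; simp; omega
    rw [this]; simp [zs]
  | succ d ih =>
    rw [zs, ← Finset.sum_fiberwise_of_maps_to (s := gapT (d + 1) N) (t := Finset.range N)
      (g := fun g => ∑ j, g j) (fun g hg => Finset.mem_range.2 ((mem_gapT g).1 hg))]
    refine Finset.sum_congr rfl fun m hm => ?_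
    have hm := Finset.mem_range.1 hm
    rw [← ih (m + 1) (by omega), Finset.sum_div]
    refine Finset.sum_bij' (fun g _ => fun j : Fin d => g j.castSucc)
      (fun g' _ => Fin.snoc (α := fun _ => ℕ) g' (m - ∑ j, g' j)) ?_ ?_ ?_ ?_ ?_
    · intro g hg
      rw [Finset.mem_filter] at hg
      rw [mem_gapT]
      have := hg.2
      rw [Fin.sum_univ_castSucc] at this
      omega
    · intro g' hg'
      rw [mem_gapT] at hg'
      have : ∑ j, Fin.snoc (α := fun _ => ℕ) g' (m - ∑ j, g' j) j = m := by
        rw [Fin.sum_univ_castSucc]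
        simp only [Fin.snoc_castSucc, Fin.snoc_last]
        omega
      rw [Finset.mem_filter, mem_gapT]
      exact ⟨by omega, this⟩
    · intro g hg
      rw [Finset.mem_filter] at hg
      have := hg.2
      rw [Fin.sum_univ_castSucc] at this
      funext j
      refine Fin.lastCases ?_ (fun j => ?_) j
      · rw [Fin.snoc_last]; dsimp only; omega
      · rw [Fin.snoc_castSucc]
    · intro g' _
      funext j
      rw [Fin.snoc_castSucc]
    · intro g hg
      rw [Finset.mem_filter] at hg
      rw [Fin.prod_univ_castSucc]
      simp only [idxSeq_castSucc, idxSeq_last, Fin.val_castSucc, Fin.val_last]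
      rw [hg.2]
      push_cast
      rw [add_comm (1 : ℝ)]
      ring

lemma zetaStar_eq (σ : ℕ → ℕ) (d : ℕ) (L : ℝ) (hL : Tendsto (fun N => zs σ d N) atTop (𝓝 L)) :
    zetaStar (fun i : Fin d => σ i) = L := by
  set f : (Fin d → ℕ) → ℝ := fun g => ∏ i : Fin d, 1 / (idxSeq g i : ℝ) ^ σ i with hf
  have hf0 : ∀ g, 0 ≤ f g := fun g => Finset.prod_nonneg fun i _ => by positivity
  have hmono : Monotone fun N => gapT d N := by
    intro a b hab g hg
    rw [mem_gapT] at *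
    omega
  have hT : Tendsto (fun N => gapT d N) atTop atTop :=
    tendsto_atTop_finset_of_monotone hmono fun g => ⟨∑ j, g j + 1, by rw [mem_gapT]; omega⟩
  have hlim : Tendsto (fun N => ∑ g ∈ gapT d N, f g) atTop (𝓝 L) := by
    refine hL.congr' ?_
    filter_upwards [eventually_ge_atTop 1] with N hN
    exact (gapT_sum σ d N hN).symm
  have hm2 : Monotone fun N => ∑ g ∈ gapT d N, f g := fun a b hab =>
    Finset.sum_le_sum_of_subset_of_nonneg (hmono hab) fun g _ _ => hf0 g
  have hsum : Summable f := by
    refine summable_of_sum_le (c := L) hf0 fun u => ?_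
    obtain ⟨N, hN⟩ := (hT.eventually_ge_atTop u).exists
    exact (Finset.sum_le_sum_of_subset_of_nonneg hN fun g _ _ => hf0 g).trans (hm2.ge_of_tendsto hlim N)
  exact tendsto_nhds_unique (hsum.hasSum.comp hT) hlim

lemma zs_nonneg (σ : ℕ → ℕ) (d N : ℕ) : 0 ≤ zs σ d N := by
  induction d generalizing N with
  | zero => simp [zs]
  | succ d ih =>
    rw [zs]
    exact Finset.sum_nonneg fun m _ => div_nonneg (ih _) (by positivity)

lemma zs_mono (σ : ℕ → ℕ) (d : ℕ) : Monotone (zs σ d) := by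
  cases d with
  | zero => intro a b _; simp [zs]
  | succ d =>
    intro a b hab
    rw [zs, zs]
    refine Finset.sum_le_sum_of_subset_of_nonneg (Finset.range_mono hab) fun m _ _ => ?_
    exact div_nonneg (zs_nonneg _ _ _) (by positivity)

lemma zetaStar_add (σ τ : ℕ → ℕ) (d d' : ℕ) (L : ℝ)
    (hL : Tendsto (fun N => zs σ d N + zs τ d' N) atTop (𝓝 L)) :
    zetaStar (fun i : Fin d => σ i) + zetaStar (fun i : Fin d' => τ i) = L := by
  have hm : Monotone fun N => zs σ d N + zs τ d' N := (zs_mono σ d).add (zs_mono τ d')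
  have hb := hm.ge_of_tendsto hL
  have l1 := tendsto_atTop_ciSup (zs_mono σ d)
    ⟨L, by rintro _ ⟨N, rfl⟩; have := hb N; have := zs_nonneg τ d' N; linarith⟩
  have l2 := tendsto_atTop_ciSup (zs_mono τ d')
    ⟨L, by rintro _ ⟨N, rfl⟩; have := hb N; have := zs_nonneg σ d N; linarith⟩
  rw [zetaStar_eq σ d _ l1, zetaStar_eq τ d' _ l2]
  exact tendsto_nhds_unique (l1.add l2) hL

lemma pat1 (n : ℕ) : (Fin.snoc (Fin.snoc (pat13 n) 1) 2 : Fin (2 * n + 1 + 1) → ℕ)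
    = fun i : Fin (2 * n + 1 + 1) => (fun j : ℕ => if j = 2 * n + 1 then 2 else if j % 2 = 0 then 1 else 3) i := by
  funext i
  refine Fin.lastCases ?_ (fun i => ?_) i
  · rw [Fin.snoc_last]; simp
  · rw [Fin.snoc_castSucc]
    refine Fin.lastCases ?_ (fun i => ?_) i
    · rw [Fin.snoc_last]; simp
    · rw [Fin.snoc_castSucc]
      have := i.isLt
      simp only [pat13, Fin.val_castSucc]
      rw [if_neg (show ¬ ((i : ℕ) = 2 * n + 1) by omega)]

lemma pat2 (n : ℕ) : (Fin.cons 3 (pat13 n) : Fin (2 * n + 1) → ℕ)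
    = fun i : Fin (2 * n + 1) => (fun j : ℕ => if j % 2 = 0 then 3 else 1) i := by
  funext i
  refine Fin.cases ?_ (fun i => ?_) i
  · simp
  · simp only [Fin.cons_succ, pat13, Fin.val_succ]
    split_ifs <;> omega

/-- `ζ⋆({1,3}^n, 1, 2) + ζ⋆(3, {1,3}^n) = (4 − 16^{−n}) ζ(4n+3)`. -/
theorem zetaStar_1313_12_add_3_1313 (n : ℕ) :
    ((zetaStar (Fin.snoc (Fin.snoc (pat13 n) 1) 2) +
        zetaStar (Fin.cons 3 (pat13 n)) : ℝ) : ℂ) =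
      (4 - 1 / 16 ^ n) * riemannZeta (4 * n + 3) := by
  have key := zetaStar_add (fun j : ℕ => if j = 2 * n + 1 then 2 else if j % 2 = 0 then 1 else 3)
    (fun j : ℕ => if j % 2 = 0 then 3 else 1) (2 * n + 1 + 1) (2 * n + 1) _
    ((cc_sum_tendsto n).congr fun N => (zs_add (fun j : ℕ => if j = 2 * n + 1 then 2 else if j % 2 = 0 then 1 else 3)
      (fun j : ℕ => if j % 2 = 0 then 3 else 1) n
      (fun j hj => by rw [if_neg (by omega), if_pos (by omega)])
      (fun j hj => by rw [if_neg (by omega), if_neg (by omega)])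
      (by rw [if_pos rfl])
      (fun j hj => by rw [if_pos (by omega)])
      (fun j hj => by rw [if_neg (by omega)]) N).symm)
  rw [← pat1, ← pat2, tsum_mul_left, eta_eq _ (by omega)] at key
  rw [key]
  have hz := zeta_nat_eq_tsum_of_gt_one (k := 4 * n + 3) (by omega)
  have hz2 : riemannZeta (4 * n + 3) = ((∑' K : ℕ, 1 / ((K : ℝ) + 1) ^ (4 * n + 3) : ℝ) : ℂ) := by
    have hs : Summable fun m : ℕ => 1 / (m : ℝ) ^ (4 * n + 3) :=
      Real.summable_one_div_nat_pow.2 (by omega)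
    have h1 := hs.tsum_eq_zero_add
    have h2 : riemannZeta (4 * n + 3) = ((∑' m : ℕ, 1 / (m : ℝ) ^ (4 * n + 3) : ℝ) : ℂ) := by
      push_cast at hz ⊢
      exact hz
    rw [h2, h1]
    simp
  rw [hz2]
  generalize (∑' K : ℕ, 1 / ((K : ℝ) + 1) ^ (4 * n + 3)) = Z
  have h16 : (2 : ℂ) ^ (4 * n + 3) = 8 * 16 ^ n := by
    rw [pow_add, pow_mul]; norm_num; ring
  push_cast
  rw [h16]
  have : (16 : ℂ) ^ n ≠ 0 := pow_ne_zero _ (by norm_num)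
  field_simp
  ring
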